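/- arXiv:1609.03618 — 4 statements merged into one kernel-verified Lean document; each statement's English description precedes it below -/
import Mathlib

section
/- A lattice polytope ∇ ⊆ ℝ^d is compressed (all facet widths equal 1) if and only if ∇ is integral-affinely equivalent to the intersection of the unit cube [0,1]^n with an affine subspace of ℝ^n, for some n. -/
open BigOperators Pointwise

/-- A ray contained in the bounded polyhedron `{x | ∀ i, c i ≤ L i x}` is constant. -/
theorem eq_zero_of_nonneg_of_isBounded {E ι : Type*} [NormedAddCommGroup E] [NormedSpace ℝ E]
    (L : ι → E →ₗ[ℝ] ℝ) (c : ι → ℝ) (hb : Bornology.IsBounded {x | ∀ i, c i ≤ L i x})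
    {p : E} (hp : ∀ i, c i ≤ L i p) {y : E} (hy : ∀ i, 0 ≤ L i y) : y = 0 := by
  obtain ⟨C, hC⟩ := hb.exists_norm_le
  by_contra hne
  have hpos : 0 < ‖y‖ := norm_pos_iff.mpr hne
  have hC0 : 0 ≤ C := (norm_nonneg p).trans (hC p hp)
  set t : ℝ := (C + ‖p‖ + 1) / ‖y‖ with ht
  have ht0 : 0 ≤ t := by positivity
  have h1 : ‖p + t • y‖ ≤ C := hC _ fun i => by
    have := mul_nonneg ht0 (hy i)
    simp only [map_add, map_smul, smul_eq_mul]
    linarith [hp i]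
  have h2 : ‖t • y‖ ≤ ‖p + t • y‖ + ‖p‖ := by
    simpa using norm_sub_le (p + t • y) p
  have h3 : ‖t • y‖ = C + ‖p‖ + 1 := by
    rw [norm_smul, Real.norm_of_nonneg ht0, ht, div_mul_cancel₀ _ hpos.ne']
  linarith

/-- Integer decomposition property: if the facet functions of a polytope take only the values
`0` and `1` on a generating set `S`, then a point of the `k`-th dilate with integral facet values
is an integral combination of `S`. -/
theorem mem_closure_of_mem_dilate {E ι : Type*} [AddCommGroup E] [Module ℝ E] (S : Finset E)
    (L : ι → E →ₗ[ℝ] ℝ) (c : ι → ℤ)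
    (hP : convexHull ℝ (S : Set E) = {x | ∀ i, (c i : ℝ) ≤ L i x})
    (h01 : ∀ v ∈ S, ∀ i, L i v = c i ∨ L i v = c i + 1)
    (hb : ∀ y, (∀ i, 0 ≤ L i y) → y = 0) (k : ℕ) :
    ∀ y, (∀ i, ∃ m : ℕ, L i y - k * c i = m) → y ∈ AddSubgroup.closure (S : Set E) := by
  induction k with
  | zero =>
    intro y hy
    have : y = 0 := hb y fun i => by
      obtain ⟨m, hm⟩ := hy i
      have : L i y = m := by simpa using hm
      rw [this]; positivity
    rw [this]; exact zero_mem _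
  | succ k ih =>
    intro y hy
    have hk : (0 : ℝ) < (k : ℝ) + 1 := by positivity
    have hz : ((k : ℝ) + 1)⁻¹ • y ∈ convexHull ℝ (S : Set E) := by
      rw [hP]
      intro i
      obtain ⟨m, hm⟩ := hy i
      rw [map_smul, smul_eq_mul, inv_mul_eq_div, le_div_iff₀ hk]
      have : (0 : ℝ) ≤ m := by positivity
      push_cast at hm
      linarith
    obtain ⟨w, hw0, hw1, hwz⟩ := Finset.mem_convexHull'.mp hz
    obtain ⟨v, hv, hwv⟩ : ∃ v ∈ S, 0 < w v := by
      by_contra! h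
      have := Finset.sum_nonpos h
      linarith
    have hyv : y - v ∈ AddSubgroup.closure (S : Set E) := by
      refine ih _ fun i => ?_
      obtain ⟨m, hm⟩ := hy i
      push_cast at hm
      rcases h01 v hv i with h | h
      · exact ⟨m, by rw [map_sub, h]; linarith⟩
      · rcases m with _ | m
        · exfalso
          have hsum : ∑ u ∈ S, w u * (L i u - c i) = 0 := by
            have h1 : L i (∑ u ∈ S, w u • u) = ((k : ℝ) + 1)⁻¹ * L i y := by
              rw [hwz, map_smul, smul_eq_mul]
            simp only [map_sum, map_smul, smul_eq_mul] at h1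
            simp only [mul_sub, Finset.sum_sub_distrib, ← Finset.sum_mul, hw1, h1]
            have h2 : L i y = (k + 1) * c i := by
              simp only [Nat.cast_zero] at hm
              linarith
            rw [h2]
            field_simp
            ring
          have hnn : ∀ u ∈ S, 0 ≤ w u * (L i u - c i) := fun u hu =>
            mul_nonneg (hw0 u hu) (by rcases h01 u hu i with h | h <;> rw [h] <;> linarith)
          have := (Finset.sum_eq_zero_iff_of_nonneg hnn).mp hsum v hv
          rw [h] at this
          have : w v = 0 := by linarith
          linarith
        · exact ⟨m, by rw [map_sub, h]; push_cast at hm; linarith⟩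
    simpa using add_mem hyv (AddSubgroup.subset_closure (Finset.mem_coe.mpr hv))

/-- For a polytope all of whose facet functions take exactly the values `0` and `1` on the
generating set `S`, every point with integral facet values is an integral combination of `S`. -/
theorem mem_closure_of_integral {E ι : Type*} [Fintype ι] [AddCommGroup E] [Module ℝ E]
    (S : Finset E) (L : ι → E →ₗ[ℝ] ℝ) (c : ι → ℤ)
    (hP : convexHull ℝ (S : Set E) = {x | ∀ i, (c i : ℝ) ≤ L i x})
    (h01 : ∀ v ∈ S, ∀ i, L i v = c i ∨ L i v = c i + 1)
    (h1 : ∀ i, ∃ v ∈ S, L i v = c i + 1)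
    (hb : ∀ y, (∀ i, 0 ≤ L i y) → y = 0) {x : E} (hx : ∀ i, ∃ m : ℤ, L i x = m) :
    x ∈ AddSubgroup.closure (S : Set E) := by
  choose m hm using hx
  set M : ℕ := ∑ i, (m i).natAbs
  have hM : ∀ i, (m i).natAbs ≤ M := fun i =>
    Finset.single_le_sum (f := fun i => (m i).natAbs) (fun _ _ => Nat.zero_le _)
      (Finset.mem_univ i)
  have hu : ∑ v ∈ S, v ∈ AddSubgroup.closure (S : Set E) :=
    sum_mem fun v hv => AddSubgroup.subset_closure (Finset.mem_coe.mpr hv)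
  have hr : ∀ i, ∃ r : ℕ, 1 ≤ r ∧ L i (∑ v ∈ S, v) - S.card * c i = r := by
    classical
    intro i
    refine ⟨(S.filter fun v => L i v = c i + 1).card, ?_, ?_⟩
    · obtain ⟨v, hv, hvi⟩ := h1 i
      exact Finset.card_pos.mpr ⟨v, Finset.mem_filter.mpr ⟨hv, hvi⟩⟩
    · have : ∀ v ∈ S, L i v = c i + if L i v = c i + 1 then 1 else 0 := by
        intro v hv
        rcases h01 v hv i with h | h <;> simp [h]
      rw [map_sum, Finset.sum_congr rfl this, Finset.sum_add_distrib]
      simp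
  have key : x + M • ∑ v ∈ S, v ∈ AddSubgroup.closure (S : Set E) := by
    refine mem_closure_of_mem_dilate S L c hP h01 hb (M * S.card) _ fun i => ?_
    obtain ⟨r, hr1, hri⟩ := hr i
    have hnn : 0 ≤ m i + M * r := by
      have h2 : M ≤ M * r := Nat.le_mul_of_pos_right _ hr1
      have h3 := hM i
      zify at h2 h3
      have := neg_abs_le (m i)
      linarith
    refine ⟨(m i + M * r).toNat, ?_⟩
    have h4 : (((m i + M * r).toNat : ℤ) : ℝ) = ((m i + M * r : ℤ) : ℝ) := by
      rw [Int.toNat_of_nonneg hnn]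
    rw [Int.cast_natCast] at h4
    rw [h4, map_add, map_nsmul, hm i, nsmul_eq_mul]
    push_cast
    rw [← hri]
    ring
  simpa using sub_mem key (nsmul_mem hu M)

/-- Finitely many affine functions of one variable that are positive at `0`, or vanish there
and are nondecreasing, are simultaneously nonnegative at some positive time. -/
theorem exists_pos_forall_add_mul_nonneg {κ : Type*} [Finite κ] (α β : κ → ℝ)
    (h : ∀ j, 0 < α j ∨ α j = 0 ∧ 0 ≤ β j) : ∃ t > 0, ∀ j, 0 ≤ α j + t * β j := by
  have hev : ∀ᶠ t in nhdsWithin (0 : ℝ) (Set.Ioi 0), ∀ j, 0 ≤ α j + t * β j := by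
    rw [Filter.eventually_all]
    intro j
    rcases h j with hj | ⟨hj, hj'⟩
    · have : Filter.Tendsto (fun t : ℝ => α j + t * β j) (nhds 0) (nhds (α j + 0 * β j)) :=
        Continuous.tendsto (by fun_prop) 0
      rw [zero_mul, add_zero] at this
      exact nhdsWithin_le_nhds
        ((this.eventually (lt_mem_nhds hj)).mono fun t ht => le_of_lt ht)
    · filter_upwards [self_mem_nhdsWithin] with t ht
      rw [hj, zero_add]
      exact mul_nonneg (le_of_lt ht) hj'
  obtain ⟨t, ht, ht0⟩ := (hev.and self_mem_nhdsWithin).exists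
  exact ⟨t, ht0, ht⟩

/-- If two finite systems of affine inequalities define the same set, then an irredundant
inequality of the first system is, up to a positive factor, an inequality of the second. -/
theorem exists_eq_mul_of_irredundant {E ι κ : Type*} [AddCommGroup E] [Module ℝ E]
    [Finite ι] [Finite κ] (l : ι → E →ᵃ[ℝ] ℝ) (m : κ → E →ᵃ[ℝ] ℝ)
    (heq : ∀ x, (∀ i, 0 ≤ l i x) ↔ ∀ j, 0 ≤ m j x) {f : ι} {p y : E}
    (hp : ∀ i, 0 < l i p) (hyf : l f y < 0) (hy : ∀ g, g ≠ f → 0 ≤ l g y) :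
    ∃ j, ∃ r > 0, ∀ x, m j x = r * l f x := by
  have hline : ∀ (h : E →ᵃ[ℝ] ℝ) (x u : E) (t : ℝ), h (x + t • u) = h x + t * h.linear u := by
    intro h x u t
    have := h.map_vadd x (t • u)
    simp only [vadd_eq_add, map_smul, smul_eq_mul] at this
    rw [add_comm x, this, add_comm]
  have hlin : ∀ (h : E →ᵃ[ℝ] ℝ) (x z : E), h.linear (x - z) = h x - h z := by
    intro h x z
    simpa using h.linearMap_vsub x z
  obtain ⟨s, hs0, hs1, hsf⟩ : ∃ s : ℝ, 0 < s ∧ s < 1 ∧ l f p + s * (l f y - l f p) = 0 := by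
    have hd : 0 < l f p - l f y := by linarith [hp f]
    refine ⟨l f p / (l f p - l f y), div_pos (hp f) hd, ?_, ?_⟩
    · rw [div_lt_one hd]; linarith
    · field_simp; ring
  set q := p + s • (y - p) with hq
  have hlq : ∀ i, l i q = l i p + s * (l i y - l i p) := fun i => by rw [hq, hline, hlin]
  have hqf : l f q = 0 := by rw [hlq, hsf]
  have hqg : ∀ g, g ≠ f → 0 < l g q := fun g hg => by
    rw [hlq]
    nlinarith [hp g, hy g hg, mul_pos (sub_pos.mpr hs1) (hp g), mul_nonneg hs0.le (hy g hg)]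
  have hqm : ∀ j, 0 ≤ m j q := (heq q).mp fun i => by
    by_cases h : i = f
    · rw [h, hqf]
    · exact (hqg i h).le
  obtain ⟨j, hjq, hjy⟩ : ∃ j, m j q = 0 ∧ m j y < 0 := by
    by_contra! hcon
    obtain ⟨t, ht0, ht⟩ := exists_pos_forall_add_mul_nonneg (fun j => m j q)
      (fun j => m j y - m j q) fun j => by
        rcases (hqm j).lt_or_eq with h | h
        · exact Or.inl h
        · exact Or.inr ⟨h.symm, by linarith [hcon j h.symm]⟩
    have := (heq (q + t • (y - q))).mpr (fun j => by rw [hline, hlin]; exact ht j) f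
    rw [hline, hlin, hqf] at this
    nlinarith
  have hnonneg : ∀ u, (l f).linear u = 0 → 0 ≤ (m j).linear u := by
    intro u hu
    obtain ⟨t, ht0, ht⟩ := exists_pos_forall_add_mul_nonneg (fun i => l i q)
      (fun i => (l i).linear u) fun i => by
        by_cases h : i = f
        · subst h; exact Or.inr ⟨hqf, hu.ge⟩
        · exact Or.inl (hqg i h)
    have := (heq (q + t • u)).mp (fun i => by rw [hline]; exact ht i) j
    rw [hline, hjq, zero_add] at this
    exact nonneg_of_mul_nonneg_right this ht0
  have hzero : ∀ u, (l f).linear u = 0 → (m j).linear u = 0 := fun u hu =>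
    le_antisymm (by simpa using hnonneg (-u) (by simp [hu])) (hnonneg u hu)
  refine ⟨j, m j y / l f y, div_pos_of_neg_of_neg hjy hyf, fun x => ?_⟩
  have := hzero ((x - q) - (l f x / l f y) • (y - q)) (by
    rw [map_sub, map_smul, hlin, hlin, hqf, smul_eq_mul]
    field_simp [hyf.ne]
    ring)
  rw [map_sub, map_smul, hlin, hlin, hjq, smul_eq_mul] at this
  have h2 : m j x = l f x / l f y * m j y := by linarith
  rw [h2]
  ring

/-- The linear functional on `ℝ^d` given by pairing with an integer vector. -/
def integerPairing {d : ℕ} (b : Fin d → ℤ) : (Fin d → ℝ) →ₗ[ℝ] ℝ where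
  toFun x := ∑ i, x i * (b i : ℝ)
  map_add' x y := by simp [add_mul, Finset.sum_add_distrib]
  map_smul' r x := by simp [Finset.mul_sum, mul_assoc]

theorem integerPairing_apply {d : ℕ} (b : Fin d → ℤ) (x : Fin d → ℝ) :
    integerPairing b x = ∑ i, x i * (b i : ℝ) := rfl

theorem integerPairing_intCast {d : ℕ} (b m : Fin d → ℤ) :
    integerPairing b (fun i => (m i : ℝ)) = ((∑ i, m i * b i : ℤ) : ℝ) := by
  simp [integerPairing_apply]

theorem integerPairing_single {d : ℕ} (b : Fin d → ℤ) (i : Fin d) :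
    integerPairing b (Pi.single i 1) = b i := by
  simp [integerPairing_apply, Pi.single_apply]

theorem integerPairing_not_constant {d : ℕ} {b : Fin d → ℤ} (hb : Finset.univ.gcd b = 1)
    {S : Set (Fin d → ℝ)} (hS : affineSpan ℝ S = ⊤) (r : ℝ) :
    ∃ v ∈ S, integerPairing b v ≠ r := by
  by_contra! h
  have hall : ∀ x, integerPairing b x = r := by
    intro x
    have hx : x ∈ affineSpan ℝ S := by rw [hS]; trivial
    refine affineSpan_induction (p := fun x => integerPairing b x = r) hx h ?_
    intro t u v w hu hv hw
    simp only [vsub_eq_sub, vadd_eq_add, map_add, map_smul, map_sub, hu, hv, hw]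
    simp
  have h0 : ∀ i, b i = 0 := fun i => by
    have h1 := hall (Pi.single i 1)
    rw [← hall 0, map_zero, integerPairing_single] at h1
    exact_mod_cast h1
  have : Finset.univ.gcd b = 0 := Finset.gcd_eq_zero_iff.mpr fun i _ => h0 i
  rw [hb] at this
  exact one_ne_zero this

/-- The slack map of a compressed lattice polytope identifies it with a slice of a unit cube. -/
theorem exists_cube_slice_of_compressed {d : ℕ} {F : Type} [Fintype F]
    (a : F → Fin d → ℤ) (c : F → ℤ) (P : Set (Fin d → ℝ)) (V : Finset (Fin d → ℤ))
    (hne : P.Nonempty)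
    (hlat : P = convexHull ℝ ((fun m : Fin d → ℤ => fun i => (m i : ℝ)) ''
      (V : Set (Fin d → ℤ))))
    (hfacet : P = {x | ∀ f, (c f : ℝ) ≤ integerPairing (a f) x})
    (hprim : ∀ f : F, Finset.univ.gcd (a f) = 1)
    (hfull : affineSpan ℝ P = ⊤)
    (hwidth : ∀ f : F, ∀ x ∈ P, integerPairing (a f) x ≤ c f + 1) :
    ∃ (n : ℕ) (W : AffineSubspace ℝ (Fin n → ℝ)) (φ : (Fin d → ℝ) →ᵃ[ℝ] (Fin n → ℝ)),
      Set.InjOn φ (affineSpan ℝ P : Set (Fin d → ℝ)) ∧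
      φ '' P = Set.Icc (0 : Fin n → ℝ) 1 ∩ (W : Set (Fin n → ℝ)) ∧
      φ '' ((affineSpan ℝ P : Set (Fin d → ℝ)) ∩
          Set.range (fun m : Fin d → ℤ => fun i => (m i : ℝ)))
        = (affineSpan ℝ (φ '' P) : Set (Fin n → ℝ)) ∩
          Set.range (fun m : Fin n → ℤ => fun i => (m i : ℝ)) := by
  classical
  set S : Finset (Fin d → ℝ) := V.image fun m i => (m i : ℝ) with hS
  have hPS : P = convexHull ℝ (S : Set (Fin d → ℝ)) := by rw [hlat, hS, Finset.coe_image]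
  have hSP : ∀ v ∈ S, v ∈ P := fun v hv => hPS ▸ subset_convexHull ℝ _ (Finset.mem_coe.mpr hv)
  have hSint : ∀ v ∈ S, ∃ m : Fin d → ℤ, (fun i => (m i : ℝ)) = v := fun v hv => by
    obtain ⟨m, _, rfl⟩ := Finset.mem_image.mp hv
    exact ⟨m, rfl⟩
  have h01 : ∀ v ∈ S, ∀ f, integerPairing (a f) v = c f ∨ integerPairing (a f) v = c f + 1 := by
    intro v hv f
    have hlo : (c f : ℝ) ≤ integerPairing (a f) v := by
      have := hSP v hv
      rw [hfacet] at this
      exact this f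
    have hhi := hwidth f v (hSP v hv)
    obtain ⟨m, rfl⟩ := hSint v hv
    rw [integerPairing_intCast] at hlo hhi ⊢
    norm_cast at hlo hhi ⊢
    omega
  have h1 : ∀ f, ∃ v ∈ S, integerPairing (a f) v = c f + 1 := by
    intro f
    obtain ⟨v, hv, hvf⟩ := integerPairing_not_constant (hprim f)
      (S := S) (by rw [← affineSpan_convexHull, ← hPS, hfull]) (c f)
    exact ⟨v, hv, (h01 v hv f).resolve_left hvf⟩
  have hb : ∀ y : Fin d → ℝ, (∀ f, 0 ≤ integerPairing (a f) y) → y = 0 := by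
    intro y hy
    obtain ⟨p, hp⟩ := hne
    have hbd : Bornology.IsBounded P := by
      rw [hPS]
      exact isBounded_convexHull.mpr S.finite_toSet.isBounded
    rw [hfacet] at hp hbd
    exact eq_zero_of_nonneg_of_isBounded _ (fun f => (c f : ℝ)) hbd hp hy
  let e := Fintype.equivFin F
  let φ : (Fin d → ℝ) →ᵃ[ℝ] (Fin (Fintype.card F) → ℝ) :=
    { toFun := fun x i => integerPairing (a (e.symm i)) x - c (e.symm i)
      linear := LinearMap.pi fun i => integerPairing (a (e.symm i))
      map_vadd' := fun x v => by ext i; simp; ring }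
  have hφ : ∀ x f, φ x (e f) = integerPairing (a f) x - c f := fun x f => by
    change integerPairing (a (e.symm (e f))) x - c (e.symm (e f)) = _
    rw [e.symm_apply_apply]
  refine ⟨_, (⊤ : AffineSubspace ℝ (Fin d → ℝ)).map φ, φ, ?_, ?_, ?_⟩
  · intro x _ y _ hxy
    refine sub_eq_zero.mp (hb _ fun f => ?_)
    have := congrFun hxy (e f)
    rw [hφ, hφ] at this
    rw [map_sub]
    linarith
  · ext z
    constructor
    · rintro ⟨x, hx, rfl⟩
      refine ⟨⟨fun i => ?_, fun i => ?_⟩, ⟨x, trivial, rfl⟩⟩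
      · obtain ⟨f, rfl⟩ := e.surjective i
        rw [hfacet] at hx
        have := hx f
        rw [hφ]; simp only [Pi.zero_apply]; linarith
      · obtain ⟨f, rfl⟩ := e.surjective i
        have := hwidth f x hx
        rw [hφ]; simp only [Pi.one_apply]; linarith
    · rintro ⟨⟨h0, -⟩, ⟨x, -, rfl⟩⟩
      refine ⟨x, ?_, rfl⟩
      rw [hfacet]
      intro f
      have : 0 ≤ φ x (e f) := h0 (e f)
      rw [hφ] at this
      linarith
  · rw [← AffineSubspace.map_span, hfull]
    ext z
    constructor
    · rintro ⟨_, ⟨-, m, rfl⟩, rfl⟩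
      refine ⟨⟨_, trivial, rfl⟩, fun i => ∑ k, m k * a (e.symm i) k - c (e.symm i), ?_⟩
      ext i
      obtain ⟨f, rfl⟩ := e.surjective i
      rw [hφ, integerPairing_intCast]
      simp
    · rintro ⟨⟨x, -, rfl⟩, m, hm⟩
      refine ⟨x, ⟨trivial, ?_⟩, rfl⟩
      have hx : x ∈ AddSubgroup.closure (S : Set (Fin d → ℝ)) := by
        refine mem_closure_of_integral S _ c (hPS ▸ hfacet) h01 h1 hb fun f => ?_
        refine ⟨m (e f) + c f, ?_⟩
        have := congrFun hm (e f)
        rw [hφ] at this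
        push_cast
        linarith
      clear hm
      induction hx using AddSubgroup.closure_induction with
      | mem v hv => exact hSint v hv
      | zero => exact ⟨0, by ext; simp⟩
      | add u v _ _ hu hv =>
        obtain ⟨k, rfl⟩ := hu
        obtain ⟨l, rfl⟩ := hv
        exact ⟨k + l, by ext; simp⟩
      | neg u _ hu =>
        obtain ⟨k, rfl⟩ := hu
        exact ⟨-k, by ext; simp⟩

/-- If a positive multiple `m` of a primitive facet function is integral on `ℤ^d` and at most `1` at
a lattice point `v` off the facet, then the factor is `1` and `v` has lattice distance `1`. -/
theorem eq_of_eq_mul_primitive {d : ℕ} {b : Fin d → ℤ} (hb : Finset.univ.gcd b = 1) (c : ℤ)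
    (m : (Fin d → ℝ) → ℝ) (hint : ∀ v : Fin d → ℤ, ∃ k : ℤ, m (fun i => (v i : ℝ)) = k)
    {r : ℝ} (hr : 0 < r) (hm : ∀ x, m x = r * (integerPairing b x - c))
    {v : Fin d → ℤ} (hv : (c : ℝ) < integerPairing b (fun i => (v i : ℝ)))
    (hv1 : m (fun i => (v i : ℝ)) ≤ 1) :
    r = 1 ∧ integerPairing b (fun i => (v i : ℝ)) = c + 1 := by
  set k : ℤ := ∑ i, v i * b i - c with hk
  have hkL : integerPairing b (fun i => (v i : ℝ)) - c = k := by
    rw [integerPairing_intCast, hk]; push_cast; ring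
  have hk0 : (0 : ℝ) < k := by rw [← hkL]; linarith
  have hrk : r * k = 1 := by
    have h1 : m (fun i => (v i : ℝ)) = r * k := by rw [hm, hkL]
    obtain ⟨j, hj⟩ := hint v
    have h2 := mul_pos hr hk0
    rw [← h1] at h2 ⊢
    rw [hj] at h2 hv1 ⊢
    norm_cast at h2 hv1 ⊢
    omega
  have hdvd : k ∣ Finset.univ.gcd b := by
    refine Finset.dvd_gcd fun i _ => ?_
    obtain ⟨s, hs⟩ := hint 0
    obtain ⟨t, ht⟩ := hint (Pi.single i 1)
    have hcast : (fun j => ((Pi.single i 1 : Fin d → ℤ) j : ℝ)) = Pi.single i 1 := by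
      ext j; by_cases h : j = i <;> simp [h]
    have hz : (fun j => ((0 : Fin d → ℤ) j : ℝ)) = 0 := by ext; simp
    rw [hcast, hm, integerPairing_single] at ht
    rw [hz, hm, map_zero] at hs
    refine ⟨t - s, ?_⟩
    have : (b i : ℝ) = k * (t - s) := by
      rw [← ht, ← hs]
      linear_combination (-(b i : ℝ)) * hrk
    exact_mod_cast this
  rw [hb] at hdvd
  have hk1 : k = 1 := Int.eq_one_of_dvd_one (by exact_mod_cast hk0.le) hdvd
  rw [hk1] at hrk hkL
  push_cast at hrk hkL
  exact ⟨by linarith, by linarith⟩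

/-- A full-dimensional lattice polytope that is an integral slice of a unit cube has all facet
widths equal to `1`. -/
theorem compressed_of_cube_slice {d : ℕ} {F : Type} [Fintype F]
    (a : F → Fin d → ℤ) (c : F → ℤ) (P : Set (Fin d → ℝ)) (V : Finset (Fin d → ℤ))
    (hne : P.Nonempty)
    (hlat : P = convexHull ℝ ((fun m : Fin d → ℤ => fun i => (m i : ℝ)) ''
      (V : Set (Fin d → ℤ))))
    (hfacet : P = {x | ∀ f, (c f : ℝ) ≤ integerPairing (a f) x})
    (hprim : ∀ f : F, Finset.univ.gcd (a f) = 1)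
    (hfull : affineSpan ℝ P = ⊤)
    (hirred : ∀ f : F, P ≠ {x | ∀ g, g ≠ f → (c g : ℝ) ≤ integerPairing (a g) x})
    {n : ℕ} (W : AffineSubspace ℝ (Fin n → ℝ)) (φ : (Fin d → ℝ) →ᵃ[ℝ] (Fin n → ℝ))
    (hinj : Function.Injective φ)
    (hφP : φ '' P = Set.Icc (0 : Fin n → ℝ) 1 ∩ (W : Set (Fin n → ℝ)))
    (hint : ∀ v : Fin d → ℤ, ∃ k : Fin n → ℤ, φ (fun i => (v i : ℝ)) = fun i => (k i : ℝ))
    (f : F) :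
    (∀ x ∈ P, integerPairing (a f) x ≤ c f + 1) ∧
      ∃ x ∈ P, integerPairing (a f) x = c f + 1 := by
  have hW : ∀ x, φ x ∈ W := by
    intro x
    have hle : affineSpan ℝ (φ '' P) ≤ W := affineSpan_le.mpr (hφP ▸ Set.inter_subset_right)
    rw [← AffineSubspace.map_span, hfull] at hle
    exact hle ⟨x, trivial, rfl⟩
  have hPφ : ∀ x, x ∈ P ↔ ∀ i, 0 ≤ φ x i ∧ φ x i ≤ 1 := by
    intro x
    rw [← hinj.mem_set_image, hφP]
    exact ⟨fun h i => ⟨h.1.1 i, h.1.2 i⟩, fun h => ⟨⟨fun i => (h i).1, fun i => (h i).2⟩, hW x⟩⟩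
  have hPL : ∀ x, x ∈ P ↔ ∀ g, (c g : ℝ) ≤ integerPairing (a g) x := fun x => by
    rw [hfacet]; rfl
  have hVP : ∀ v ∈ V, (fun i => (v i : ℝ)) ∈ P := fun v hv =>
    hlat ▸ subset_convexHull ℝ _ ⟨v, hv, rfl⟩
  have hpos : ∀ g, ∃ v ∈ V, (c g : ℝ) < integerPairing (a g) (fun i => (v i : ℝ)) := by
    intro g
    rw [hlat, affineSpan_convexHull] at hfull
    obtain ⟨_, ⟨v, hv, rfl⟩, hne'⟩ := integerPairing_not_constant (hprim g) hfull (c g)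
    exact ⟨v, hv, lt_of_le_of_ne ((hPL _).mp (hVP v hv) g) hne'.symm⟩
  have hVne : V.Nonempty := by
    rw [hlat] at hne
    simpa using hne
  have hcard : (0 : ℝ) < V.card := by exact_mod_cast hVne.card_pos
  let l : F → (Fin d → ℝ) →ᵃ[ℝ] ℝ := fun g =>
    (integerPairing (a g)).toAffineMap - AffineMap.const ℝ _ (c g : ℝ)
  have hl : ∀ g x, l g x = integerPairing (a g) x - c g := fun g x => rfl
  let m : Fin n ⊕ Fin n → (Fin d → ℝ) →ᵃ[ℝ] ℝ := Sum.elim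
    (fun i => (LinearMap.proj i : (Fin n → ℝ) →ₗ[ℝ] ℝ).toAffineMap.comp φ)
    (fun i => AffineMap.const ℝ _ (1 : ℝ) -
      (LinearMap.proj i : (Fin n → ℝ) →ₗ[ℝ] ℝ).toAffineMap.comp φ)
  have hml : ∀ i x, m (Sum.inl i) x = φ x i := fun i x => rfl
  have hmr : ∀ i x, m (Sum.inr i) x = 1 - φ x i := fun i x => rfl
  have heq : ∀ x, (∀ g, 0 ≤ l g x) ↔ ∀ j, 0 ≤ m j x := by
    intro x
    simp only [hl, Sum.forall, hml, hmr, sub_nonneg, ← forall_and]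
    rw [← hPL, hPφ]
  obtain ⟨p, hp⟩ : ∃ p, ∀ g, 0 < l g p := by
    refine ⟨(V.card : ℝ)⁻¹ • ∑ v ∈ V, fun i => (v i : ℝ), fun g => ?_⟩
    have hlt : ∑ v ∈ V, (c g : ℝ) < ∑ v ∈ V, integerPairing (a g) (fun i => (v i : ℝ)) :=
      Finset.sum_lt_sum (fun v hv => (hPL _).mp (hVP v hv) g) (hpos g)
    rw [Finset.sum_const, nsmul_eq_mul] at hlt
    rw [hl, map_smul, map_sum, smul_eq_mul, inv_mul_eq_div, sub_pos, lt_div_iff₀ hcard]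
    linarith
  obtain ⟨y, hy, hyf⟩ : ∃ y, (∀ g, g ≠ f → (c g : ℝ) ≤ integerPairing (a g) y) ∧
      integerPairing (a f) y < c f := by
    by_contra! h
    refine hirred f (Set.ext fun x => ⟨fun hx g _ => (hPL x).mp hx g, fun hx => ?_⟩)
    refine (hPL x).mpr fun g => ?_
    by_cases hg : g = f
    · exact hg ▸ h x hx
    · exact hx g hg
  obtain ⟨j, r, hr, hjr⟩ := exists_eq_mul_of_irredundant l m heq (f := f) hp
    (by rw [hl]; linarith) (fun g hg => by rw [hl]; linarith [hy g hg])
  have hle : ∀ x ∈ P, m j x ≤ 1 := by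
    intro x hx
    rcases j with i | i
    · exact ((hPφ x).mp hx i).2
    · rw [hmr]; linarith [((hPφ x).mp hx i).1]
  have hmint : ∀ v : Fin d → ℤ, ∃ k : ℤ, m j (fun i => (v i : ℝ)) = k := by
    intro v
    obtain ⟨k, hk⟩ := hint v
    rcases j with i | i
    · exact ⟨k i, by rw [hml, hk]⟩
    · exact ⟨1 - k i, by rw [hmr, hk]; push_cast; rfl⟩
  obtain ⟨v, hv, hvf⟩ := hpos f
  obtain ⟨rfl, hvL⟩ := eq_of_eq_mul_primitive (hprim f) (c f) (m j) hmint hr hjr hvf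
    (hle _ (hVP v hv))
  refine ⟨fun x hx => ?_, _, hVP v hv, hvL⟩
  have := hle x hx
  rw [hjr, hl] at this
  linarith

/-- A lattice polytope (given by an irredundant facet presentation) is
compressed (all facet widths equal 1) iff it is integral-affinely equivalent to the
intersection of a unit cube with an affine subspace. -/
theorem compressed_iff_cube_slice
    (d : ℕ) (F : Type) [Fintype F]
    (a : F → Fin d → ℤ) (c : F → ℤ)
    (P : Set (Fin d → ℝ)) (V : Finset (Fin d → ℤ))
    (hne : P.Nonempty)
    (hlat : P = convexHull ℝ ((fun m : Fin d → ℤ => fun i => (m i : ℝ)) ''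
      (V : Set (Fin d → ℤ))))
    -- facet presentation with primitive integral normals:
    (hfacet : P = {x : Fin d → ℝ | ∀ f : F, (c f : ℝ) ≤ ∑ i, x i * (a f i : ℝ)})
    (hprim : ∀ f : F, Finset.univ.gcd (a f) = 1)
    -- the polytope is full-dimensional and each inequality defines a facet
    -- (the presentation is irredundant):
    (hfull : affineSpan ℝ P = ⊤)
    (hirred : ∀ f : F,
      P ≠ {x : Fin d → ℝ | ∀ g : F, g ≠ f → (c g : ℝ) ≤ ∑ i, x i * (a g i : ℝ)}) :
    -- compressed:
    ((∀ f : F, ∀ x ∈ P, ∑ i, x i * (a f i : ℝ) ≤ c f + 1) ∧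
     (∀ f : F, ∃ x ∈ P, ∑ i, x i * (a f i : ℝ) = c f + 1))
    ↔
    -- integral-affinely equivalent to the intersection of a unit cube with an
    -- affine subspace:
    (∃ (n : ℕ) (W : AffineSubspace ℝ (Fin n → ℝ)) (φ : (Fin d → ℝ) →ᵃ[ℝ] (Fin n → ℝ)),
      Set.InjOn φ (affineSpan ℝ P : Set (Fin d → ℝ)) ∧
      φ '' P = Set.Icc (0 : Fin n → ℝ) 1 ∩ (W : Set (Fin n → ℝ)) ∧
      φ '' ((affineSpan ℝ P : Set (Fin d → ℝ)) ∩
          Set.range (fun m : Fin d → ℤ => fun i => (m i : ℝ)))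
        = (affineSpan ℝ (φ '' P) : Set (Fin n → ℝ)) ∩
          Set.range (fun m : Fin n → ℤ => fun i => (m i : ℝ))) := by
  constructor
  · rintro ⟨hwidth, -⟩
    exact exists_cube_slice_of_compressed a c P V hne hlat hfacet hprim hfull hwidth
  · rintro ⟨n, W, φ, hinj, hφP, hφZ⟩
    have hinj' : Function.Injective φ := by
      rwa [hfull, AffineSubspace.top_coe, Set.injOn_univ] at hinj
    have hint : ∀ v : Fin d → ℤ, ∃ k : Fin n → ℤ,
        φ (fun i => (v i : ℝ)) = fun i => (k i : ℝ) := by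
      intro v
      have hv : φ (fun i => (v i : ℝ)) ∈ φ '' ((affineSpan ℝ P : Set (Fin d → ℝ)) ∩
          Set.range (fun m : Fin d → ℤ => fun i => (m i : ℝ))) :=
        ⟨_, ⟨by rw [hfull]; trivial, v, rfl⟩, rfl⟩
      rw [hφZ] at hv
      obtain ⟨-, k, hk⟩ := hv
      exact ⟨k, hk.symm⟩
    have key := compressed_of_cube_slice a c P V hne hlat hfacet hprim hfull hirred W φ hinj'
      hφP hint
    exact ⟨fun f => (key f).1, fun f => (key f).2⟩
end

section
/- Let ι : R ↪ S be a graded algebra retract of finitely generated graded ℂ-algebras (i.e. there is a graded surjection φ : S ↠ R with φ ∘ ι = id_R). If for every homogeneous prime ideal q of S not containing the irrelevant ideal the homogeneous localization S_(q) is a regular local ring, then for every homogeneous prime ideal p of R not containing the irrelevant ideal the homogeneous localization R_(p) is a regular local ring. -/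
open BigOperators

/-- A regular local ring: a Noetherian local ring whose maximal ideal is generated
by as many elements as the Krull dimension. -/
def IsRegularLocal (A : Type) [CommRing A] : Prop :=
  IsLocalRing A ∧ IsNoetherianRing A ∧
  ∃ s : Finset A, (Ideal.span (s : Set A)).IsMaximal ∧
    (s.card : WithBot (WithTop ℕ)) = ringKrullDim A

open IsLocalRing

lemma isRegularLocal_iff_isRegularLocalRing (A : Type) [CommRing A] :
    IsRegularLocal A ↔ IsRegularLocalRing A := by
  constructor
  · rintro ⟨_, _, s, hmax, hs⟩
    refine IsRegularLocalRing.of_spanFinrank_maximalIdeal_le A ?_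
    rw [← hs, ← eq_maximalIdeal hmax]
    have h : (Ideal.span (s : Set A)).spanFinrank ≤ s.card := by
      simpa using Submodule.spanFinrank_span_le_ncard_of_finite (R := A) s.finite_toSet
    exact Nat.cast_le.mpr h
  · intro h
    obtain ⟨s, hs, hspan⟩ := Submodule.FG.exists_span_finset_card_eq_spanFinrank
      (maximalIdeal A).fg_of_isNoetherianRing
    refine ⟨inferInstance, inferInstance, s, ?_, ?_⟩
    · rw [Ideal.span, hspan]
      infer_instance
    · rw [hs]
      exact h.spanFinrank_maximalIdeal

section LocalRetract

variable {A B : Type*} [CommRing A] [CommRing B]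

section

variable [IsLocalRing B]

lemma mem_span_sup_sq_of_toCotangent_mem_span {s : Set (maximalIdeal B)} {x : maximalIdeal B}
    (hx : (maximalIdeal B).toCotangent x ∈
      Submodule.span (ResidueField B) ((maximalIdeal B).toCotangent '' s)) :
    (x : B) ∈ Ideal.span (Subtype.val '' s) ⊔ maximalIdeal B ^ 2 := by
  have hx' : (maximalIdeal B).toCotangent x ∈
      (Submodule.span B s).map (maximalIdeal B).toCotangent := by
    rw [Submodule.map_span, ← Submodule.restrictScalars_span B (ResidueField B) residue_surjective]
    exact hx
  obtain ⟨y, hy, hyx⟩ := hx'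
  have hy' : (y : B) ∈ Ideal.span (Subtype.val '' s) := by
    have := Submodule.mem_map_of_mem (f := (maximalIdeal B).subtype) hy
    rwa [Submodule.map_span] at this
  rw [← sub_add_cancel (x : B) y, add_comm]
  exact Submodule.add_mem_sup hy' ((Ideal.toCotangent_eq _).mp hyx.symm)

lemma sub_retraction_mem_smul_ker (i : A →+* B) (f : B →+* A) [IsLocalHom (i.comp f)]
    (hfi : f.comp i = RingHom.id A) {x : B} (hx : x ∈ maximalIdeal B ^ 2) :
    x - i (f x) ∈ maximalIdeal B • RingHom.ker f := by
  have hker (b : B) : b - i (f b) ∈ RingHom.ker f := by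
    rw [RingHom.mem_ker, map_sub, sub_eq_zero]
    exact (DFunLike.congr_fun hfi (f b)).symm
  rw [pow_two] at hx
  refine Submodule.mul_induction_on hx (fun a ha b hb ↦ ?_) (fun a b ha hb ↦ ?_)
  · have hb' : i (f b) ∈ maximalIdeal B := by
      rw [mem_maximalIdeal, mem_nonunits_iff] at hb ⊢
      exact fun h ↦ hb (isUnit_of_map_unit (i.comp f) b h)
    have : a * b - i (f (a * b)) = a • (b - i (f b)) + i (f b) • (a - i (f a)) := by
      simp only [map_mul, smul_eq_mul]
      ring
    rw [this]
    exact add_mem (Submodule.smul_mem_smul ha (hker b)) (Submodule.smul_mem_smul hb' (hker a))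
  · have : a + b - i (f (a + b)) = (a - i (f a)) + (b - i (f b)) := by
      simp only [map_add]
      ring
    rw [this]
    exact add_mem ha hb

lemma spanFinrank_maximalIdeal_add_spanFinrank_ker_le [IsLocalRing A] [IsNoetherianRing B]
    (i : A →+* B) (f : B →+* A) [IsLocalHom f] (hfi : f.comp i = RingHom.id A) :
    (maximalIdeal A).spanFinrank + (RingHom.ker f).spanFinrank ≤
      (maximalIdeal B).spanFinrank := by
  have hfs : Function.Surjective f := fun a ↦ ⟨i a, DFunLike.congr_fun hfi a⟩
  have : IsNoetherianRing A := isNoetherianRing_of_surjective B A f hfs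
  have : IsLocalHom i := ⟨fun a ha ↦ by simpa [← RingHom.comp_apply, hfi] using ha.map f⟩
  have : IsLocalHom (i.comp f) := RingHom.isLocalHom_comp i f
  have hKm : RingHom.ker f ≤ maximalIdeal B := le_maximalIdeal (RingHom.ker_ne_top f)
  have hcomap : (maximalIdeal A).comap f = maximalIdeal B := maximalIdeal_comap f
  have hmap : (maximalIdeal B).map f ≤ maximalIdeal A := Ideal.map_le_iff_le_comap.mpr hcomap.ge
  let t := (maximalIdeal B).toCotangent
  let K : Set (maximalIdeal B) := {x | f x = 0}
  obtain ⟨b₀, hb₀K, hb₀span, hb₀⟩ := exists_linearIndependent (ResidueField B) (t '' K)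
  obtain ⟨b, -, hb₀b, hbspan, hb⟩ := exists_linearIndepOn_id_extension
    (K := ResidueField B) hb₀ (Set.subset_univ b₀)
  have hbfin : b.Finite := hb.setFinite
  have hbcard : b.ncard ≤ (maximalIdeal B).spanFinrank := by
    rw [spanFinrank_maximalIdeal_eq_finrank_cotangentSpace]
    have := hbfin.fintype
    rw [← Nat.card_coe_set_eq, Nat.card_eq_fintype_card]
    exact LinearIndependent.fintype_card_le_finrank hb
  obtain ⟨k, hkK, hk⟩ := Set.SurjOn.exists_bijOn_subset (show Set.SurjOn t K b₀ from hb₀K)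
  obtain ⟨a, -, ha⟩ := Set.SurjOn.exists_bijOn_subset (s := Set.univ) (f := t) (t := b \ b₀)
    fun x _ ↦ by simpa using (maximalIdeal B).toCotangent_surjective x
  have hkfin : k.Finite := hk.finite_iff_finite.mpr (hbfin.subset hb₀b)
  have hafin : a.Finite := ha.finite_iff_finite.mpr hbfin.sdiff
  have hcard : a.ncard + k.ncard = b.ncard := by
    rw [← ha.injOn.ncard_image, ← hk.injOn.ncard_image, ha.image_eq,
      hk.image_eq, Set.ncard_sdiff_add_ncard_of_subset hb₀b hbfin]
  have hker : RingHom.ker f ≤ Ideal.span (Subtype.val '' k) := by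
    refine Submodule.le_of_le_smul_of_le_jacobson_bot (RingHom.ker f).fg_of_isNoetherianRing
      (maximalIdeal_le_jacobson ⊥) fun x hx ↦ ?_
    have hxk := mem_span_sup_sq_of_toCotangent_mem_span (s := k) (x := ⟨x, hKm hx⟩) <| by
      rw [hk.image_eq, hb₀span]
      exact Submodule.subset_span ⟨_, hx, rfl⟩
    obtain ⟨y, hy, z, hz, hyz⟩ := Submodule.mem_sup.mp hxk
    have hyK : f y = 0 := by
      have : Ideal.span (Subtype.val '' k) ≤ RingHom.ker f := by
        rw [Ideal.span_le]
        rintro _ ⟨w, hw, rfl⟩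
        exact hkK hw
      exact this hy
    have hzK : f z = 0 := by
      have : f (y + z) = 0 := by rw [hyz]; exact hx
      simpa [hyK] using this
    have hz' := sub_retraction_mem_smul_ker i f hfi hz
    rw [hzK, map_zero, sub_zero] at hz'
    rw [← show y + z = x from hyz]
    exact Submodule.add_mem_sup hy hz'
  have hmax : maximalIdeal A ≤ Ideal.span (f '' (Subtype.val '' a)) := by
    refine Submodule.le_of_le_smul_of_le_jacobson_bot (maximalIdeal A).fg_of_isNoetherianRing
      (maximalIdeal_le_jacobson ⊥) fun x hx ↦ ?_
    obtain ⟨x, rfl⟩ := hfs x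
    have hxa := mem_span_sup_sq_of_toCotangent_mem_span (s := a ∪ k) (x := ⟨x, hcomap.le hx⟩) <| by
      rw [Set.image_union, ha.image_eq, hk.image_eq, Set.sdiff_union_of_subset hb₀b]
      exact hbspan (Set.mem_univ _)
    have := Ideal.mem_map_of_mem f hxa
    rw [Ideal.map_sup, Ideal.map_span, Ideal.map_pow, Set.image_union, Set.image_union,
      Ideal.span_union] at this
    refine SetLike.le_def.mp (sup_le (sup_le le_sup_left ?_) ?_) this
    · rw [Ideal.span_le]
      rintro _ ⟨_, ⟨w, hw, rfl⟩, rfl⟩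
      rw [show f w = 0 from hkK hw]
      exact zero_mem _
    · rw [smul_eq_mul, ← pow_two]
      exact (Ideal.pow_right_mono hmap 2).trans le_sup_right
  have hker' : RingHom.ker f = Ideal.span (Subtype.val '' k) := by
    refine hker.antisymm (Ideal.span_le.mpr ?_)
    rintro _ ⟨w, hw, rfl⟩
    exact hkK hw
  have hmax' : maximalIdeal A = Ideal.span (f '' (Subtype.val '' a)) := by
    refine hmax.antisymm (Ideal.span_le.mpr ?_)
    rintro _ ⟨_, ⟨w, -, rfl⟩, rfl⟩
    exact hmap (Ideal.mem_map_of_mem f w.2)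
  have hk_le : (RingHom.ker f).spanFinrank ≤ k.ncard := by
    rw [hker']
    exact (Submodule.spanFinrank_span_le_ncard_of_finite (hkfin.image _)).trans
      (Set.ncard_image_le hkfin)
  have ha_le : (maximalIdeal A).spanFinrank ≤ a.ncard := by
    rw [hmax']
    exact (Submodule.spanFinrank_span_le_ncard_of_finite ((hafin.image _).image _)).trans
      ((Set.ncard_image_le (hafin.image _)).trans (Set.ncard_image_le hafin))
  lia

end

/-- A retract of a regular local ring is a regular local ring. -/
theorem IsRegularLocalRing.of_retract [IsLocalRing A] [IsRegularLocalRing B]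
    (i : A →+* B) (f : B →+* A) [IsLocalHom f] (hfi : f.comp i = RingHom.id A) :
    IsRegularLocalRing A := by
  have hfs : Function.Surjective f := fun a ↦ ⟨i a, DFunLike.congr_fun hfi a⟩
  have : IsNoetherianRing A := isNoetherianRing_of_surjective B A f hfs
  apply IsRegularLocalRing.of_spanFinrank_maximalIdeal_le
  have hdim : ringKrullDim B ≤ ringKrullDim A + (RingHom.ker f).spanFinrank := by
    rw [← ringKrullDim_eq_of_ringEquiv (RingHom.quotientKerEquivOfSurjective hfs)]
    refine ringKrullDim_le_ringKrullDim_quotient_add_spanFinrank _ ?_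
    rw [ringJacobson_eq_maximalIdeal]
    exact le_maximalIdeal (RingHom.ker_ne_top f)
  have hle : ((maximalIdeal A).spanFinrank + (RingHom.ker f).spanFinrank : WithBot ℕ∞) ≤
      ringKrullDim A + (RingHom.ker f).spanFinrank := by
    refine le_trans ?_ hdim
    rw [← IsRegularLocalRing.spanFinrank_maximalIdeal]
    exact_mod_cast spanFinrank_maximalIdeal_add_spanFinrank_ker_le i f hfi
  exact ENat.WithBot.add_le_add_natCast_right_iff.mp hle

end LocalRetract

/-- if `ι : R ↪ S` is a graded algebra retract of finitely generated
graded `ℂ`-algebras and all homogeneous localizations of `S` at relevant homogeneous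
primes are regular, then the same holds for `R`. -/
theorem proj_smooth_of_graded_retract
    (R S : Type) [CommRing R] [CommRing S] [Algebra ℂ R] [Algebra ℂ S]
    (hfgR : Algebra.FiniteType ℂ R) (hfgS : Algebra.FiniteType ℂ S)
    (ℬ : ℕ → Submodule ℂ R) (𝒜 : ℕ → Submodule ℂ S)
    [GradedAlgebra ℬ] [GradedAlgebra 𝒜]
    (ι : R →ₐ[ℂ] S) (φ : S →ₐ[ℂ] R)
    (hι : Function.Injective ι) (hφ : Function.Surjective φ)
    (hretract : φ.comp ι = AlgHom.id ℂ R)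
    (hιgr : ∀ (n : ℕ) (x : R), x ∈ ℬ n → ι x ∈ 𝒜 n)
    (hφgr : ∀ (n : ℕ) (y : S), y ∈ 𝒜 n → φ y ∈ ℬ n)
    (hS : ∀ (q : Ideal S) [q.IsPrime], Ideal.IsHomogeneous 𝒜 q →
      ¬ (HomogeneousIdeal.irrelevant 𝒜).toIdeal ≤ q →
      IsRegularLocal (HomogeneousLocalization.AtPrime 𝒜 q)) :
    ∀ (p : Ideal R) [p.IsPrime], Ideal.IsHomogeneous ℬ p →
      ¬ (HomogeneousIdeal.irrelevant ℬ).toIdeal ≤ p →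
      IsRegularLocal (HomogeneousLocalization.AtPrime ℬ p) := by
  intro p _ hp hirr
  let iG : ℬ →+*ᵍ 𝒜 := { ι.toRingHom with map_mem := fun {n x} ↦ hιgr n x }
  let fG : 𝒜 →+*ᵍ ℬ := { φ.toRingHom with map_mem := fun {n y} ↦ hφgr n y }
  have hφι (x : R) : φ (ι x) = x := DFunLike.congr_fun hretract x
  let q : Ideal S := p.comap fG
  have hpq : p = q.comap iG := by
    ext x
    change x ∈ p ↔ φ (ι x) ∈ p
    rw [hφι]
  have hq : q.IsHomogeneous 𝒜 := by
    intro n y hy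
    change φ _ ∈ p
    have := hp n hy
    rwa [← GradedRingHom.map_directSumDecompose] at this
  have hqirr : ¬ (HomogeneousIdeal.irrelevant 𝒜).toIdeal ≤ q := by
    rw [HomogeneousIdeal.toIdeal_irrelevant_le] at hirr ⊢
    refine fun h ↦ hirr fun n hn x hx ↦ ?_
    have : φ (ι x) ∈ p := h n hn (hιgr n x hx)
    rwa [hφι] at this
  have := (isRegularLocal_iff_isRegularLocalRing _).mp (hS q hq hqirr)
  rw [isRegularLocal_iff_isRegularLocalRing]
  refine IsRegularLocalRing.of_retract
    (HomogeneousLocalization.localRingHom iG p q hpq)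
    (HomogeneousLocalization.localRingHom fG q p rfl) ?_
  ext1 x
  obtain ⟨c, rfl⟩ := HomogeneousLocalization.mk_surjective x
  apply HomogeneousLocalization.val_injective
  change Localization.mk (φ (ι c.num)) ⟨φ (ι c.den), _⟩ = Localization.mk c.num.1 ⟨c.den, _⟩
  simp only [hφι]
end

section
/- Let ∇ be a compressed lattice polytope with no two neighbouring singular vertices (i.e. for every edge of ∇, at least one endpoint is a smooth vertex). Then the toric ideal I(∇) is generated by its elements of degree two. -/
open BigOperators Pointwise

/-- The toric ideal associated to a family of lattice points `m : ι → M`. -/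
noncomputable def toricIdeal {ι M : Type} [AddCommMonoid M] (m : ι → M) :
    Ideal (MvPolynomial ι ℂ) :=
  RingHom.ker (MvPolynomial.aeval
    (fun i => (AddMonoidAlgebra.single ((m i, 1) : M × ℤ) (1 : ℂ) :
      AddMonoidAlgebra ℂ (M × ℤ)))).toRingHom

/-- An ideal of a polynomial ring is generated in degree at most `r`. -/
def GeneratedInDegreeLE {ι : Type} (I : Ideal (MvPolynomial ι ℂ)) (r : ℕ) : Prop :=
  I = Ideal.span {p : MvPolynomial ι ℂ | p ∈ I ∧ p.totalDegree ≤ r}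

/-- A lattice point `v` of a polytope `P ⊆ ℝ^d` is a smooth vertex: the cone of `P`
at `v` is generated by lattice vectors forming a `ℤ`-basis of the lattice points of
its span. -/
def IsSmoothVertexOf {d : ℕ} (P : Set (Fin d → ℝ)) (v : Fin d → ℤ) : Prop :=
  ∃ (r : ℕ) (g : Fin r → Fin d → ℤ),
    LinearIndependent ℝ (fun j => fun i => ((g j i : ℤ) : ℝ)) ∧
    {y : Fin d → ℝ | ∃ s : ℝ, 0 ≤ s ∧ ∃ x ∈ P, y = s • (x - fun i => (v i : ℝ))}
      = {y | ∃ lam : Fin r → ℝ, (∀ j, 0 ≤ lam j) ∧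
          y = ∑ j, lam j • fun i => ((g j i : ℤ) : ℝ)} ∧
    ∀ p : Fin d → ℤ, (fun i => ((p i : ℤ) : ℝ)) ∈
        Submodule.span ℝ (Set.range fun j => fun i => ((g j i : ℤ) : ℝ)) →
      ∃ z : Fin r → ℤ, p = ∑ j, z j • g j

/-- Two lattice points of `P` are neighbouring vertices: the segment between them is
an edge of `P` with no intermediate lattice point. -/
def Neighbouring {d : ℕ} (P : Set (Fin d → ℝ)) (v w : Fin d → ℤ) : Prop :=
  v ≠ w ∧
  (fun i => (v i : ℝ)) ∈ Set.extremePoints ℝ P ∧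
  (fun i => (w i : ℝ)) ∈ Set.extremePoints ℝ P ∧
  IsExtreme ℝ P (segment ℝ (fun i => (v i : ℝ)) (fun i => (w i : ℝ))) ∧
  ¬ ∃ p : Fin d → ℤ,
    (fun i => (p i : ℝ)) ∈ openSegment ℝ (fun i => (v i : ℝ)) (fun i => (w i : ℝ)) ∧
    p ≠ v ∧ p ≠ w

section Binomials

open MvPolynomial

variable {ι M : Type} [AddCommMonoid M]

theorem aeval_prod_X_eq_single (m : ι → M) (A : Multiset ι) :
    MvPolynomial.aeval (fun i => (AddMonoidAlgebra.single ((m i, 1) : M × ℤ) (1 : ℂ) :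
      AddMonoidAlgebra ℂ (M × ℤ))) (A.map (X : ι → MvPolynomial ι ℂ)).prod =
    AddMonoidAlgebra.single ((A.map m).sum, (A.card : ℤ)) 1 := by
  induction A using Multiset.induction_on with
  | empty =>
    rw [Multiset.map_zero, Multiset.prod_zero, map_one]
    simp [AddMonoidAlgebra.one_def, Prod.zero_eq_mk]
  | cons i A ih =>
    simp only [Multiset.map_cons, Multiset.prod_cons, map_mul, aeval_X, ih,
      AddMonoidAlgebra.single_mul_single, Multiset.sum_cons, Multiset.card_cons, mul_one,
      Prod.mk_add_mk, Nat.cast_add, Nat.cast_one, add_comm (1 : ℤ)]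

theorem prod_X_sub_prod_X_mem_toricIdeal {m : ι → M} {A B : Multiset ι}
    (hcard : A.card = B.card) (hsum : (A.map m).sum = (B.map m).sum) :
    (A.map (X : ι → MvPolynomial ι ℂ)).prod - (B.map X).prod ∈ toricIdeal m := by
  refine RingHom.mem_ker.mpr ?_
  rw [map_sub]
  refine sub_eq_zero.mpr ?_
  exact (aeval_prod_X_eq_single m A).trans
    (by rw [hcard, hsum]; exact (aeval_prod_X_eq_single m B).symm)

/-- A toric ideal is contained in every ideal that contains its binomials. -/
theorem toricIdeal_le_of_binomials_mem {m : ι → M} {J : Ideal (MvPolynomial ι ℂ)}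
    (hJ : ∀ A B : Multiset ι, A.card = B.card → (A.map m).sum = (B.map m).sum →
      (A.map X).prod - (B.map X).prod ∈ J) :
    toricIdeal m ≤ J := by
  classical
  let deg : Multiset ι → M × ℤ := fun A => ((A.map m).sum, (A.card : ℤ))
  let φ := MvPolynomial.aeval (R := ℂ) (fun i =>
    (AddMonoidAlgebra.single ((m i, 1) : M × ℤ) (1 : ℂ) : AddMonoidAlgebra ℂ (M × ℤ)))
  let T : AddMonoidAlgebra ℂ (M × ℤ) →ₗ[ℂ] MvPolynomial ι ℂ :=
    Finsupp.linearCombination ℂ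
      (fun e => ((Function.invFun deg e).map (X : ι → MvPolynomial ι ℂ)).prod) ∘ₗ
      (AddMonoidAlgebra.coeffLinearEquiv ℂ).toLinearMap
  have hT : ∀ p, p - T (φ p) ∈ J := by
    intro p
    induction p using MvPolynomial.induction_on' with
    | monomial u z =>
      have hu : monomial u z = z • (u.toMultiset.map (X : ι → MvPolynomial ι ℂ)).prod := by
        rw [Finsupp.toMultiset_map, Finsupp.prod_toMultiset, monomial_eq, smul_eq_C_mul,
          Finsupp.prod_mapDomain_index (by simp) (by simp [pow_add])]
      have hdeg : deg (Function.invFun deg (deg u.toMultiset)) = deg u.toMultiset :=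
        Function.invFun_eq ⟨_, rfl⟩
      have hφ : T (φ (u.toMultiset.map X).prod) =
          ((Function.invFun deg (deg u.toMultiset)).map X).prod := by
        rw [show φ (u.toMultiset.map X).prod = _ from aeval_prod_X_eq_single m _]
        simp [T, deg]
      rw [hu, map_smul, map_smul, ← smul_sub, hφ]
      refine Submodule.smul_of_tower_mem _ _ (hJ _ _ ?_ ?_)
      · exact Nat.cast_injective (R := ℤ) (congrArg Prod.snd hdeg).symm
      · exact (congrArg Prod.fst hdeg).symm
    | add p q hp hq =>
      rw [map_add, map_add, add_sub_add_comm]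
      exact J.add_mem hp hq
  intro p hp
  have h0 : φ p = 0 := RingHom.mem_ker.mp hp
  simpa [h0] using hT p

/-- It suffices to connect fibres of multisets by exchanging two elements at a time. -/
theorem generatedInDegreeLE_two_of_exchange {m : ι → M}
    (h : ∀ R : Multiset ι → Multiset ι → Prop, Equivalence R →
      (∀ i A B, R A B → R (i ::ₘ A) (i ::ₘ B)) →
      (∀ i j i' j' A, m i + m j = m i' + m j' → R (i ::ₘ j ::ₘ A) (i' ::ₘ j' ::ₘ A)) →
      ∀ A B : Multiset ι, A.card = B.card → (A.map m).sum = (B.map m).sum → R A B) :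
    GeneratedInDegreeLE (toricIdeal m) 2 := by
  refine le_antisymm (toricIdeal_le_of_binomials_mem ?_)
    (Ideal.span_le.mpr fun p hp => hp.1)
  set J := Ideal.span {p : MvPolynomial ι ℂ | p ∈ toricIdeal m ∧ p.totalDegree ≤ 2} with hJ
  refine h (fun A B => (A.map X).prod - (B.map X).prod ∈ J)
    ⟨fun A => by simp, fun {A B} hAB => by simpa using J.neg_mem hAB,
      fun {A B C} hAB hBC => by simpa using J.add_mem hAB hBC⟩ ?_ ?_
  · intro i A B hAB
    simpa only [Multiset.map_cons, Multiset.prod_cons, ← mul_sub] using J.mul_mem_left (X i) hAB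
  · intro i j i' j' A hij
    have hmem : (X i * X j - X i' * X j' : MvPolynomial ι ℂ) ∈ J := by
      refine Ideal.subset_span ⟨?_, ?_⟩
      · simpa using prod_X_sub_prod_X_mem_toricIdeal (m := m) (A := {i, j}) (B := {i', j'})
          (by simp) (by simpa using hij)
      · have hdeg (a b : ι) : (X a * X b : MvPolynomial ι ℂ).totalDegree ≤ 2 :=
          (totalDegree_mul _ _).trans (by simp)
        exact (totalDegree_sub _ _).trans (max_le (hdeg i j) (hdeg i' j'))
    have := J.mul_mem_right (A.map X).prod hmem
    simpa only [Multiset.map_cons, Multiset.prod_cons, sub_mul, mul_assoc] using this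

end Binomials

section LatticeVectors

variable {d : ℕ}

/-- The real vector underlying an integral vector. -/
def latticeVec : (Fin d → ℤ) →+ (Fin d → ℝ) := (Int.castAddHom ℝ).compLeft (Fin d)

theorem latticeVec_eq (p : Fin d → ℤ) : latticeVec p = fun i => (p i : ℝ) := rfl

theorem latticeVec_injective : Function.Injective (latticeVec (d := d)) := fun _ _ h =>
  funext fun i => Int.cast_injective (α := ℝ) (congrFun h i)

theorem latticeVec_dotProduct (p q : Fin d → ℤ) :
    latticeVec p ⬝ᵥ latticeVec q = ((p ⬝ᵥ q : ℤ) : ℝ) := by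
  simp [dotProduct, latticeVec_eq]

theorem latticeVec_sum_smul {r : ℕ} (g : Fin r → Fin d → ℤ) (z : Fin r → ℤ) :
    latticeVec (∑ i, z i • g i) = ∑ i, (z i : ℝ) • latticeVec (g i) := by
  rw [map_sum]
  refine Finset.sum_congr rfl fun i _ => ?_
  rw [map_zsmul, Int.cast_smul_eq_zsmul]

/-- The coordinates of lattice points with respect to the lattice basis at a smooth vertex. -/
theorem IsSmoothVertexOf.exists_coordinates {P : Set (Fin d → ℝ)} {v : Fin d → ℤ}
    (hv : IsSmoothVertexOf P v) :
    ∃ (r : ℕ) (g : Fin r → Fin d → ℤ),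
      (∀ z z' : Fin r → ℤ, ∑ i, z i • g i = ∑ i, z' i • g i → z = z') ∧
      (∀ p, latticeVec p ∈ P → ∃ μ : Fin r → ℕ, p = v + ∑ i, (μ i : ℤ) • g i) ∧
      ∀ i, ∃ s : ℝ, 0 ≤ s ∧ ∃ x ∈ P, latticeVec (g i) = s • (x - latticeVec v) := by
  obtain ⟨r, g, hli, hcone, hlattice⟩ := hv
  change LinearIndependent ℝ fun j => latticeVec (g j) at hli
  have hinj (z z' : Fin r → ℝ)
      (h : ∑ i, z i • latticeVec (g i) = ∑ i, z' i • latticeVec (g i)) : z = z' := by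
    have := Fintype.linearIndependent_iff.mp hli (z - z')
      (by simp [sub_smul, Finset.sum_sub_distrib, h])
    exact funext fun i => sub_eq_zero.mp (this i)
  refine ⟨r, g, fun z z' h => ?_, fun p hp => ?_, fun i => ?_⟩
  · have := hinj (fun i => z i) (fun i => z' i)
      (by rw [← latticeVec_sum_smul, h, latticeVec_sum_smul])
    exact funext fun i => Int.cast_injective (α := ℝ) (congrFun this i)
  · obtain ⟨lam, hlam, hp'⟩ := hcone.subset
      (show latticeVec (p - v) ∈ _ from ⟨1, zero_le_one, _, hp, by rw [one_smul, map_sub]; rfl⟩)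
    change latticeVec (p - v) = ∑ j, lam j • latticeVec (g j) at hp'
    obtain ⟨z, hz⟩ := hlattice (p - v) (by
      change latticeVec (p - v) ∈ _
      rw [hp']
      exact Submodule.sum_mem _ fun j _ =>
        Submodule.smul_mem _ _ (Submodule.subset_span ⟨j, rfl⟩))
    have hzlam := hinj (fun i => z i) lam (by rw [← latticeVec_sum_smul, ← hz, hp'])
    have hz0 (i : Fin r) : 0 ≤ z i := by
      have : (0 : ℝ) ≤ z i := (hlam i).trans_eq (congrFun hzlam i).symm
      exact_mod_cast this
    refine ⟨fun i => (z i).toNat, ?_⟩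
    simp only [Int.toNat_of_nonneg (hz0 _), ← hz, add_sub_cancel]
  · refine hcone.superset ⟨Pi.single i 1, fun j => ?_, ?_⟩
    · by_cases h : j = i
      · subst h; simp
      · simp [h]
    · change latticeVec (g i) = ∑ j, (Pi.single i 1 : Fin r → ℝ) j • latticeVec (g j)
      simp [Pi.single_apply, ite_smul]

end LatticeVectors

/-- `P` is a nonempty polytope with lattice points enumerated by `m`, all of whose facet widths
with respect to the presentation `(a, c)` are at most one. -/
structure IsCompressedPresentation {d k : ℕ} {F : Type} (a : F → Fin d → ℤ) (c : F → ℤ)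
    (P : Set (Fin d → ℝ)) (m : Fin k → Fin d → ℤ) : Prop where
  nonempty : P.Nonempty
  eq_convexHull : P = convexHull ℝ (Set.range fun j => latticeVec (m j))
  injective : Function.Injective m
  latticeVec_mem_iff : ∀ p, latticeVec p ∈ P ↔ p ∈ Set.range m
  mem_iff : ∀ x, x ∈ P ↔ ∀ f, (c f : ℝ) ≤ x ⬝ᵥ latticeVec (a f)
  dotProduct_le : ∀ f, ∀ x ∈ P, x ⬝ᵥ latticeVec (a f) ≤ c f + 1

namespace IsCompressedPresentation

variable {d k : ℕ} {F : Type} {a : F → Fin d → ℤ} {c : F → ℤ}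
  {P : Set (Fin d → ℝ)} {m : Fin k → Fin d → ℤ}

theorem latticeVec_mem (hP : IsCompressedPresentation a c P m) (j : Fin k) :
    latticeVec (m j) ∈ P :=
  (hP.latticeVec_mem_iff _).mpr ⟨j, rfl⟩

theorem le_dotProduct (hP : IsCompressedPresentation a c P m) (f : F) (j : Fin k) :
    c f ≤ m j ⬝ᵥ a f := by
  have := (hP.mem_iff _).mp (hP.latticeVec_mem j) f
  rw [latticeVec_dotProduct] at this
  exact_mod_cast this

theorem dotProduct_le_add_one (hP : IsCompressedPresentation a c P m) (f : F) (j : Fin k) :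
    m j ⬝ᵥ a f ≤ c f + 1 := by
  have := hP.dotProduct_le f _ (hP.latticeVec_mem j)
  rw [latticeVec_dotProduct] at this
  exact_mod_cast this

theorem dotProduct_eq_or (hP : IsCompressedPresentation a c P m) (f : F) (j : Fin k) :
    m j ⬝ᵥ a f = c f ∨ m j ⬝ᵥ a f = c f + 1 := by
  have := hP.le_dotProduct f j
  have := hP.dotProduct_le_add_one f j
  omega

theorem exists_eq (hP : IsCompressedPresentation a c P m) {p : Fin d → ℤ}
    (hp : ∀ f, c f ≤ p ⬝ᵥ a f) : ∃ j, m j = p := by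
  refine (hP.latticeVec_mem_iff p).mp ((hP.mem_iff _).mpr fun f => ?_)
  rw [latticeVec_dotProduct]
  exact_mod_cast hp f

theorem exists_weights (hP : IsCompressedPresentation a c P m) {x : Fin d → ℝ} (hx : x ∈ P) :
    ∃ w : Fin k → ℝ, (∀ j, 0 ≤ w j) ∧ ∑ j, w j = 1 ∧ ∑ j, w j • latticeVec (m j) = x := by
  rw [hP.eq_convexHull, convexHull_range_eq_exists_affineCombination] at hx
  obtain ⟨s, w, hw0, hw1, rfl⟩ := hx
  classical
  refine ⟨fun j => if j ∈ s then w j else 0, fun j => ?_, by simpa using hw1, ?_⟩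
  · dsimp only
    split_ifs with h
    exacts [hw0 j h, le_rfl]
  · rw [Finset.affineCombination_eq_linear_combination _ _ _ hw1]
    simp [ite_smul]

theorem eq_zero_of_dotProduct_nonneg (hP : IsCompressedPresentation a c P m) {y : Fin d → ℝ}
    (hy : ∀ f, 0 ≤ y ⬝ᵥ latticeVec (a f)) : y = 0 := by
  obtain ⟨x, hx⟩ := hP.nonempty
  have hbdd : Bornology.IsBounded P := by
    rw [hP.eq_convexHull, isBounded_convexHull]
    exact (Set.finite_range _).isBounded
  obtain ⟨R, hR⟩ := isBounded_iff_forall_norm_le.mp hbdd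
  by_contra hy0
  have hmem (t : ℕ) : x + (t : ℝ) • y ∈ P := by
    refine (hP.mem_iff _).mpr fun f => ?_
    rw [add_dotProduct, smul_dotProduct, smul_eq_mul]
    exact ((hP.mem_iff x).mp hx f).trans
      (le_add_of_nonneg_right (mul_nonneg t.cast_nonneg (hy f)))
  obtain ⟨t, ht⟩ := exists_nat_gt ((R + R) / ‖y‖)
  have hlt := (div_lt_iff₀ (norm_pos_iff.mpr hy0)).mp ht
  have hle : ‖(t : ℝ) • y‖ ≤ R + R := by
    calc ‖(t : ℝ) • y‖ = ‖(x + (t : ℝ) • y) - x‖ := by rw [add_sub_cancel_left]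
      _ ≤ R + R := (norm_sub_le _ _).trans (add_le_add (hR _ (hmem t)) (hR _ hx))
  rw [norm_smul, Real.norm_natCast] at hle
  exact hle.not_gt hlt

theorem ext_dotProduct (hP : IsCompressedPresentation a c P m) {x y : Fin d → ℝ}
    (h : ∀ f, x ⬝ᵥ latticeVec (a f) = y ⬝ᵥ latticeVec (a f)) : x = y :=
  sub_eq_zero.mp (hP.eq_zero_of_dotProduct_nonneg fun f => by rw [sub_dotProduct, h f, sub_self])

theorem ext_index (hP : IsCompressedPresentation a c P m) {u v : Fin k}
    (h : ∀ f, m u ⬝ᵥ a f = m v ⬝ᵥ a f) : u = v := by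
  refine hP.injective (latticeVec_injective (hP.ext_dotProduct fun f => ?_))
  rw [latticeVec_dotProduct, latticeVec_dotProduct, h f]

/-- A facet coordinate that is extremal at an interior point of a segment in `P` is constant along
the segment. -/
theorem dotProduct_eq_of_mem_openSegment (hP : IsCompressedPresentation a c P m) {f : F}
    {x y z : Fin d → ℝ} (hx : x ∈ P) (hy : y ∈ P) (hz : z ∈ openSegment ℝ x y) {u : Fin k}
    (hzu : z ⬝ᵥ latticeVec (a f) = (m u ⬝ᵥ a f : ℤ)) :
    x ⬝ᵥ latticeVec (a f) = (m u ⬝ᵥ a f : ℤ) := by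
  obtain ⟨s, t, hs, ht, hst, rfl⟩ := hz
  simp only [add_dotProduct, smul_dotProduct, smul_eq_mul] at hzu
  have hx0 := (hP.mem_iff x).mp hx f
  have hy0 := (hP.mem_iff y).mp hy f
  have hx1 := hP.dotProduct_le f x hx
  have hy1 := hP.dotProduct_le f y hy
  obtain rfl : t = 1 - s := by linarith
  rcases hP.dotProduct_eq_or f u with h | h <;> rw [h] at hzu ⊢ <;> push_cast at hzu ⊢ <;> nlinarith

theorem mem_extremePoints (hP : IsCompressedPresentation a c P m) (u : Fin k) :
    latticeVec (m u) ∈ Set.extremePoints ℝ P := by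
  refine ⟨hP.latticeVec_mem u, fun x hx y hy hu => hP.ext_dotProduct fun f => ?_⟩
  rw [hP.dotProduct_eq_of_mem_openSegment hx hy hu (latticeVec_dotProduct _ _),
    latticeVec_dotProduct]

/-- If a facet coordinate of a convex combination of vertices is extremal, then it agrees with that
of all vertices that occur. -/
theorem dotProduct_eq_of_weights (hP : IsCompressedPresentation a c P m) {f : F}
    {w : Fin k → ℝ} (hw0 : ∀ j, 0 ≤ w j) (hw1 : ∑ j, w j = 1) {e : ℤ}
    (he : e = c f ∨ e = c f + 1)
    (hu : (∑ j, w j • latticeVec (m j)) ⬝ᵥ latticeVec (a f) = e)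
    {j : Fin k} (hj : w j ≠ 0) : m j ⬝ᵥ a f = e := by
  simp only [sum_dotProduct, smul_dotProduct, latticeVec_dotProduct, smul_eq_mul] at hu
  have hzero : ∑ j, w j * (((m j ⬝ᵥ a f : ℤ) : ℝ) - e) = 0 := by
    simp only [mul_sub, Finset.sum_sub_distrib, hu, ← Finset.sum_mul, hw1, one_mul, sub_self]
  have hterm : w j * (((m j ⬝ᵥ a f : ℤ) : ℝ) - e) = 0 := by
    rcases he with h | h
    · refine (Finset.sum_eq_zero_iff_of_nonneg fun i _ => mul_nonneg (hw0 i) ?_).mp hzero j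
        (Finset.mem_univ j)
      rw [h, sub_nonneg]
      exact_mod_cast hP.le_dotProduct f i
    · refine (Finset.sum_eq_zero_iff_of_nonpos fun i _ =>
        mul_nonpos_of_nonneg_of_nonpos (hw0 i) ?_).mp hzero j (Finset.mem_univ j)
      rw [h, sub_nonpos]
      exact_mod_cast hP.dotProduct_le_add_one f i
  exact_mod_cast sub_eq_zero.mp ((mul_eq_zero.mp hterm).resolve_left hj)

/-- Two vertices are neighbouring as soon as no other vertex lies in the smallest face that
contains both. -/
theorem neighbouring (hP : IsCompressedPresentation a c P m) {u v : Fin k} (huv : u ≠ v)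
    (hedge : ∀ j, (∀ f, m u ⬝ᵥ a f = m v ⬝ᵥ a f → m j ⬝ᵥ a f = m u ⬝ᵥ a f) → j = u ∨ j = v) :
    Neighbouring P (m u) (m v) := by
  have hsegment : segment ℝ (latticeVec (m u)) (latticeVec (m v)) ⊆ P := by
    rw [hP.eq_convexHull]
    exact segment_subset_convexHull ⟨u, rfl⟩ ⟨v, rfl⟩
  refine ⟨hP.injective.ne huv, hP.mem_extremePoints u, hP.mem_extremePoints v,
    ⟨hsegment, fun x hx y hy z hz hzxy => ?_⟩, ?_⟩
  · have hxu (f : F) (hf : m u ⬝ᵥ a f = m v ⬝ᵥ a f) :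
        x ⬝ᵥ latticeVec (a f) = (m u ⬝ᵥ a f : ℤ) := by
      refine hP.dotProduct_eq_of_mem_openSegment hx hy hzxy ?_
      obtain ⟨s, t, -, -, hst, rfl⟩ := hz
      change (s • latticeVec (m u) + t • latticeVec (m v)) ⬝ᵥ _ = _
      rw [add_dotProduct, smul_dotProduct, smul_dotProduct, latticeVec_dotProduct,
        latticeVec_dotProduct, ← hf, ← add_smul, hst, one_smul]
    obtain ⟨w, hw0, hw1, rfl⟩ := hP.exists_weights hx
    have hsupp (j : Fin k) (hj : j ≠ u ∧ j ≠ v) : w j = 0 := by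
      by_contra hwj
      exact (hedge j fun f hf => hP.dotProduct_eq_of_weights hw0 hw1
        (hP.dotProduct_eq_or f u) (hxu f hf) hwj).elim
        hj.1 hj.2
    rw [Fintype.sum_eq_add u v huv hsupp] at hw1
    rw [Fintype.sum_eq_add u v huv fun j hj => by rw [hsupp j hj, zero_smul]]
    exact ⟨w u, w v, hw0 u, hw0 v, hw1, rfl⟩
  · rintro ⟨p, hp, hpu, -⟩
    obtain ⟨j, rfl⟩ := (hP.latticeVec_mem_iff p).mp (hsegment (openSegment_subset_segment _ _ _ hp))
    exact hpu (latticeVec_injective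
      ((hP.mem_extremePoints j).2 (hP.latticeVec_mem u) (hP.latticeVec_mem v) hp).symm)

/-- Compressed polytopes are normal. -/
theorem exists_multiset_sum_eq (hP : IsCompressedPresentation a c P m) (n : ℕ) (s : Fin d → ℤ)
    (hs : ∀ f, n * c f ≤ s ⬝ᵥ a f) :
    ∃ A : Multiset (Fin k), A.card = n ∧ (A.map m).sum = s := by
  induction n generalizing s with
  | zero =>
    refine ⟨0, rfl, ?_⟩
    have : latticeVec s = 0 := hP.eq_zero_of_dotProduct_nonneg fun f => by
      rw [latticeVec_dotProduct]
      exact_mod_cast (by simpa using hs f : 0 ≤ s ⬝ᵥ a f)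
    exact (latticeVec_injective (this.trans (map_zero _).symm)).symm
  | succ n ih =>
    have hn : (0 : ℝ) < (n + 1 : ℕ) := by positivity
    have hx : ((n + 1 : ℕ) : ℝ)⁻¹ • latticeVec s ∈ P := by
      refine (hP.mem_iff _).mpr fun f => ?_
      rw [smul_dotProduct, latticeVec_dotProduct, smul_eq_mul, le_inv_mul_iff₀ hn]
      exact_mod_cast hs f
    obtain ⟨w, hw0, hw1, hw⟩ := hP.exists_weights hx
    obtain ⟨j, hj⟩ : ∃ j, w j ≠ 0 := by
      by_contra! h
      simp [h] at hw1
    obtain ⟨A, hA, hsum⟩ := ih (s - m j) fun f => by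
      rw [sub_dotProduct]
      have h1 := hP.dotProduct_le_add_one f j
      have h0 := hP.le_dotProduct f j
      have hsf := hs f
      push_cast at hsf
      by_contra! hlt
      have heq : s ⬝ᵥ a f = (n + 1) * c f := by linarith
      have hmj : m j ⬝ᵥ a f = c f := by
        refine hP.dotProduct_eq_of_weights hw0 hw1 (Or.inl rfl) ?_ hj
        rw [hw, smul_dotProduct, latticeVec_dotProduct, heq, smul_eq_mul, inv_mul_eq_iff_eq_mul₀
          hn.ne']
        push_cast
        rfl
      linarith
    exact ⟨j ::ₘ A, by simp [hA], by simp [hsum]⟩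

theorem card_mul_le_sum_dotProduct (hP : IsCompressedPresentation a c P m) (f : F)
    (A : Multiset (Fin k)) : A.card * c f ≤ (A.map m).sum ⬝ᵥ a f := by
  induction A using Multiset.induction_on with
  | empty => simp
  | cons j A ih =>
    rw [Multiset.map_cons, Multiset.sum_cons, add_dotProduct, Multiset.card_cons]
    push_cast
    linarith [hP.le_dotProduct f j]

/-- Along an edge from a smooth vertex `v` to `u`, a decomposition containing `v` can be changed by
a single exchange into one containing `u`, provided such a decomposition exists. -/
theorem exists_exchange (hP : IsCompressedPresentation a c P m) {u v : Fin k}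
    (hv : IsSmoothVertexOf P (m v)) (huv : u ≠ v)
    (hedge : ∀ j, (∀ f, m u ⬝ᵥ a f = m v ⬝ᵥ a f → m j ⬝ᵥ a f = m u ⬝ᵥ a f) → j = u ∨ j = v)
    {A B : Multiset (Fin k)} (hvA : v ∈ A) (huB : u ∈ B) (hcard : A.card = B.card)
    (hsum : (A.map m).sum = (B.map m).sum) :
    ∃ w w' C, A = v ::ₘ w ::ₘ C ∧ m v + m w = m u + m w' := by
  obtain ⟨r, g, hinj, hcoord, hcone⟩ := hv.exists_coordinates
  choose μ hμ using fun j => hcoord (m j) (hP.latticeVec_mem j)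
  have hpos (f : F) (hf : m v ⬝ᵥ a f = c f) (i : Fin r) : 0 ≤ g i ⬝ᵥ a f := by
    obtain ⟨s, hs, x, hx, hg⟩ := hcone i
    have : (0 : ℝ) ≤ (g i ⬝ᵥ a f : ℤ) := by
      rw [← latticeVec_dotProduct, hg, smul_dotProduct, sub_dotProduct, latticeVec_dotProduct, hf]
      exact mul_nonneg hs (sub_nonneg.mpr ((hP.mem_iff x).mp hx f))
    exact_mod_cast this
  have hneg (f : F) (hf : m v ⬝ᵥ a f = c f + 1) (i : Fin r) : g i ⬝ᵥ a f ≤ 0 := by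
    obtain ⟨s, hs, x, hx, hg⟩ := hcone i
    have : ((g i ⬝ᵥ a f : ℤ) : ℝ) ≤ 0 := by
      rw [← latticeVec_dotProduct, hg, smul_dotProduct, sub_dotProduct, latticeVec_dotProduct, hf]
      refine mul_nonpos_of_nonneg_of_nonpos hs (sub_nonpos.mpr ?_)
      exact_mod_cast hP.dotProduct_le f x hx
    exact_mod_cast this
  have hdot (j : Fin k) (f : F) :
      m j ⬝ᵥ a f = m v ⬝ᵥ a f + ∑ i, (μ j i : ℤ) * (g i ⬝ᵥ a f) := by
    conv_lhs => rw [hμ j]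
    simp only [add_dotProduct, sum_dotProduct, smul_dotProduct, smul_eq_mul]
  have hle (f : F) (hf : m v ⬝ᵥ a f = c f) {j : Fin k} {i : Fin r} (hi : μ j i ≠ 0) :
      m v ⬝ᵥ a f + g i ⬝ᵥ a f ≤ m j ⬝ᵥ a f := by
    rw [hdot j f, add_le_add_iff_left]
    refine le_trans ?_ (Finset.single_le_sum (f := fun i => (μ j i : ℤ) * (g i ⬝ᵥ a f))
      (fun i _ => mul_nonneg (Int.natCast_nonneg _) (hpos f hf i)) (Finset.mem_univ i))
    exact le_mul_of_one_le_left (hpos f hf i) (by exact_mod_cast Nat.one_le_iff_ne_zero.mpr hi)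
  have hge (f : F) (hf : m v ⬝ᵥ a f = c f + 1) {j : Fin k} {i : Fin r} (hi : μ j i ≠ 0) :
      m j ⬝ᵥ a f ≤ m v ⬝ᵥ a f + g i ⬝ᵥ a f := by
    have h1 : -(g i ⬝ᵥ a f) ≤ ∑ i, (μ j i : ℤ) * -(g i ⬝ᵥ a f) := by
      refine le_trans ?_ (Finset.single_le_sum (f := fun i => (μ j i : ℤ) * -(g i ⬝ᵥ a f))
        (fun i _ => mul_nonneg (Int.natCast_nonneg _) (neg_nonneg.mpr (hneg f hf i)))
        (Finset.mem_univ i))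
      exact le_mul_of_one_le_left (neg_nonneg.mpr (hneg f hf i))
        (by exact_mod_cast Nat.one_le_iff_ne_zero.mpr hi)
    simp only [mul_neg, Finset.sum_neg_distrib] at h1
    linarith [hdot j f]
  obtain ⟨e, he⟩ : ∃ e, μ u e ≠ 0 := by
    by_contra! h
    exact huv (hP.injective (by rw [hμ u]; simp [h]))
  have hu : m u = m v + g e := by
    obtain ⟨j, hj⟩ := hP.exists_eq (p := m v + g e) fun f => by
      rw [add_dotProduct]
      rcases hP.dotProduct_eq_or f v with hf | hf
      · linarith [hpos f hf e]
      · exact (hP.le_dotProduct f u).trans (hge f hf he)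
    have hface (f : F) (huvf : m u ⬝ᵥ a f = m v ⬝ᵥ a f) : m j ⬝ᵥ a f = m u ⬝ᵥ a f := by
      rw [hj, add_dotProduct]
      rcases hP.dotProduct_eq_or f v with hf | hf
      · linarith [hpos f hf e, hle f hf he]
      · linarith [hneg f hf e, hge f hf he]
    rcases hedge j hface with rfl | rfl
    · exact hj
    · have hg : g e = 0 := by simpa using hj
      have := congrFun (hinj (Pi.single e 1) 0 (by
        simp only [Pi.single_apply, ite_smul, one_smul, zero_smul, Finset.sum_ite_eq',
          Finset.mem_univ, if_true, hg, Pi.zero_apply, Finset.sum_const_zero])) e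
      simp at this
  have hcoordsum (A : Multiset (Fin k)) : (A.map m).sum =
      A.card • m v + ∑ i, (((A.map fun j => μ j i).sum : ℕ) : ℤ) • g i := by
    induction A using Multiset.induction_on with
    | empty => simp
    | cons j A ih =>
      simp only [Multiset.map_cons, Multiset.sum_cons, Multiset.card_cons, Nat.cast_add, add_smul,
        Finset.sum_add_distrib, ih, one_smul]
      conv_lhs => rw [hμ j]
      abel
  have hAB : (A.map fun j => μ j e).sum = (B.map fun j => μ j e).sum := by
    have := hsum
    rw [hcoordsum A, hcoordsum B, hcard, add_right_inj] at this
    exact_mod_cast congrFun (hinj _ _ this) e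
  have hBpos : (B.map fun j => μ j e).sum ≠ 0 := fun h =>
    he (Multiset.sum_eq_zero_iff.mp h _ (Multiset.mem_map_of_mem _ huB))
  obtain ⟨w, hwA, hw⟩ : ∃ w ∈ A, μ w e ≠ 0 := by
    by_contra! h
    exact hBpos (hAB ▸ Multiset.sum_eq_zero_iff.mpr fun x hx => by
      obtain ⟨w, hwA, rfl⟩ := Multiset.mem_map.mp hx
      exact h w hwA)
  have hwv : w ≠ v := by
    rintro rfl
    have := congrFun (hinj (fun i => μ w i) 0 (by simpa using hμ w)) e
    exact hw (Int.natCast_eq_zero.mp this)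
  obtain ⟨A, rfl⟩ := Multiset.exists_cons_of_mem hvA
  obtain ⟨C, rfl⟩ := Multiset.exists_cons_of_mem ((Multiset.mem_cons.mp hwA).resolve_left hwv)
  obtain ⟨w', hw'⟩ := hP.exists_eq (p := m w - g e) fun f => by
    rw [sub_dotProduct]
    rcases hP.dotProduct_eq_or f v with hf | hf
    · linarith [hle f hf hw]
    · linarith [hneg f hf e, hP.le_dotProduct f w]
  exact ⟨w, w', C, rfl, by rw [hu, hw']; abel⟩

/-- Any two decompositions of a lattice point into equally many vertices are related by a sequence
of exchanges of two vertices. -/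
theorem rel_of_sum_eq [Fintype F] (hP : IsCompressedPresentation a c P m)
    (hsing : ∀ v w : Fin d → ℤ, Neighbouring P v w →
      IsSmoothVertexOf P v ∨ IsSmoothVertexOf P w)
    {R : Multiset (Fin k) → Multiset (Fin k) → Prop} (hR : Equivalence R)
    (hcons : ∀ i A B, R A B → R (i ::ₘ A) (i ::ₘ B))
    (hexchange : ∀ i j i' j' A, m i + m j = m i' + m j' → R (i ::ₘ j ::ₘ A) (i' ::ₘ j' ::ₘ A))
    (n : ℕ) (A B : Multiset (Fin k)) (hA : A.card = n) (hB : B.card = n)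
    (hsum : (A.map m).sum = (B.map m).sum) : R A B := by
  induction n generalizing A B with
  | zero =>
    rw [Multiset.card_eq_zero.mp hA, Multiset.card_eq_zero.mp hB]
    exact hR.refl 0
  | succ n ih =>
    have hcommon (u : Fin k) (A B : Multiset (Fin k)) (hA : A.card = n + 1) (hB : B.card = n + 1)
        (hsum : (A.map m).sum = (B.map m).sum) (huA : u ∈ A) (huB : u ∈ B) : R A B := by
      obtain ⟨A, rfl⟩ := Multiset.exists_cons_of_mem huA
      obtain ⟨B, rfl⟩ := Multiset.exists_cons_of_mem huB
      exact hcons u A B (ih A B (by simpa using hA) (by simpa using hB) (by simpa using hsum))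
    have hsmooth (u v : Fin k) (A B : Multiset (Fin k)) (hA : A.card = n + 1)
        (hB : B.card = n + 1) (hsum : (A.map m).sum = (B.map m).sum) (hvA : v ∈ A) (huB : u ∈ B)
        (hv : IsSmoothVertexOf P (m v)) (huv : u ≠ v)
        (hedge : ∀ j, (∀ f, m u ⬝ᵥ a f = m v ⬝ᵥ a f → m j ⬝ᵥ a f = m u ⬝ᵥ a f) →
          j = u ∨ j = v) : R A B := by
      obtain ⟨w, w', C, rfl, hw⟩ := hP.exists_exchange hv huv hedge hvA huB (hA.trans hB.symm) hsum
      refine hR.trans (hexchange v w u w' C hw)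
        (hcommon u _ B (by simpa using hA) hB ?_ (Multiset.mem_cons_self _ _) huB)
      rw [← hsum]
      simp only [Multiset.map_cons, Multiset.sum_cons, ← add_assoc, hw]
    classical
    have hclaim (N : ℕ) (u v : Fin k)
        (hN : (Finset.univ.filter fun f => m u ⬝ᵥ a f ≠ m v ⬝ᵥ a f).card = N)
        (A B : Multiset (Fin k)) (hA : A.card = n + 1) (hB : B.card = n + 1)
        (hsum : (A.map m).sum = (B.map m).sum) (huA : u ∈ A) (hvB : v ∈ B) : R A B := by
      induction N using Nat.strong_induction_on generalizing u v A B with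
      | _ N ihN =>
        by_cases huv : u = v
        · subst huv
          exact hcommon u A B hA hB hsum huA hvB
        by_cases hedge : ∀ j, (∀ f, m u ⬝ᵥ a f = m v ⬝ᵥ a f → m j ⬝ᵥ a f = m u ⬝ᵥ a f) →
            j = u ∨ j = v
        · rcases hsing _ _ (hP.neighbouring huv hedge) with hu | hv
          · refine hsmooth v u A B hA hB hsum huA hvB hu (Ne.symm huv) fun j hj => ?_
            exact (hedge j fun f hf => (hj f hf.symm).trans hf.symm).symm
          · exact hR.symm (hsmooth u v B A hB hA hsum.symm hvB huA hv huv hedge)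
        · push Not at hedge
          obtain ⟨j, hj, hju, hjv⟩ := hedge
          have hor (f : F) : m j ⬝ᵥ a f = m u ⬝ᵥ a f ∨ m j ⬝ᵥ a f = m v ⬝ᵥ a f := by
            have := hj f
            have := hP.dotProduct_eq_or f u
            have := hP.dotProduct_eq_or f v
            have := hP.dotProduct_eq_or f j
            omega
          obtain ⟨C, hC, hCsum⟩ := hP.exists_multiset_sum_eq n ((A.map m).sum - m j) fun f => by
            obtain ⟨A', rfl⟩ := Multiset.exists_cons_of_mem huA
            obtain ⟨B', rfl⟩ := Multiset.exists_cons_of_mem hvB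
            simp only [Multiset.card_cons, Nat.add_right_cancel_iff] at hA hB
            have hA' := hP.card_mul_le_sum_dotProduct f A'
            have hB' := hP.card_mul_le_sum_dotProduct f B'
            have hsum' := congrArg (· ⬝ᵥ a f) hsum
            simp only [Multiset.map_cons, Multiset.sum_cons, add_dotProduct] at hsum'
            rw [hA] at hA'
            rw [hB] at hB'
            rw [Multiset.map_cons, Multiset.sum_cons, sub_dotProduct, add_dotProduct]
            rcases hor f with h | h <;> linarith
          have hjC : ((j ::ₘ C).map m).sum = (A.map m).sum := by simp [hCsum]
          have hcardC : (j ::ₘ C).card = n + 1 := by simp [hC]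
          refine hR.trans (y := j ::ₘ C) ?_ ?_
          · refine ihN _ ?_ u j rfl A _ hA hcardC hjC.symm huA (Multiset.mem_cons_self _ _)
            obtain ⟨f, hf⟩ : ∃ f, m j ⬝ᵥ a f ≠ m v ⬝ᵥ a f := by
              by_contra! h
              exact hjv (hP.ext_index h)
            rw [← hN]
            refine Finset.card_lt_card (Finset.ssubset_iff_of_subset ?_ |>.mpr ⟨f, ?_, ?_⟩)
            · intro f
              simpa using fun h h' => h (hj f h').symm
            · simpa [(hor f).resolve_right hf] using hf
            · simpa using ((hor f).resolve_right hf).symm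
          · refine ihN _ ?_ j v rfl _ B hcardC hB (hjC.trans hsum) (Multiset.mem_cons_self _ _) hvB
            obtain ⟨f, hf⟩ : ∃ f, m j ⬝ᵥ a f ≠ m u ⬝ᵥ a f := by
              by_contra! h
              exact hju (hP.ext_index h)
            rw [← hN]
            refine Finset.card_lt_card (Finset.ssubset_iff_of_subset ?_ |>.mpr ⟨f, ?_, ?_⟩)
            · intro f
              simpa using fun h h' => h ((hj f h').trans h')
            · simpa using fun h => hf (hj f h)
            · simpa using (hor f).resolve_left hf
    obtain ⟨u, huA⟩ := Multiset.card_pos_iff_exists_mem.mp (n.succ_pos.trans_eq hA.symm)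
    obtain ⟨v, hvB⟩ := Multiset.card_pos_iff_exists_mem.mp (n.succ_pos.trans_eq hB.symm)
    exact hclaim _ u v rfl A B hA hB hsum huA hvB

end IsCompressedPresentation


/-- the toric ideal of a compressed lattice polytope with no two
neighbouring singular vertices is generated in degree two. -/
theorem toricIdeal_deg_two_of_no_neighbouring_singular
    (d : ℕ) (F : Type) [Fintype F]
    (a : F → Fin d → ℤ) (c : F → ℤ)
    (P : Set (Fin d → ℝ)) (k : ℕ) (m : Fin k → Fin d → ℤ)
    -- `P` is a lattice polytope with lattice points enumerated by `m`:
    (hlat : P = convexHull ℝ (Set.range fun j => fun i => ((m j i : ℤ) : ℝ)))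
    (hinj : Function.Injective m)
    (henum : ∀ p : Fin d → ℤ, (fun i => (p i : ℝ)) ∈ P ↔ p ∈ Set.range m)
    -- facet presentation with primitive integral normals:
    (hfacet : P = {x : Fin d → ℝ | ∀ f : F, (c f : ℝ) ≤ ∑ i, x i * (a f i : ℝ)})
    (hprim : ∀ f : F, Finset.univ.gcd (a f) = 1)
    -- compressed:
    (hwidth : ∀ f : F, ∀ x ∈ P, ∑ i, x i * (a f i : ℝ) ≤ c f + 1)
    (hwidth' : ∀ f : F, ∃ x ∈ P, ∑ i, x i * (a f i : ℝ) = c f + 1)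
    -- no two neighbouring singular vertices:
    (hsing : ∀ v w : Fin d → ℤ, Neighbouring P v w →
      IsSmoothVertexOf P v ∨ IsSmoothVertexOf P w) :
    GeneratedInDegreeLE (toricIdeal m) 2 := by
  have hne : P.Nonempty := by
    by_contra hempty
    have hF : IsEmpty F := ⟨fun f => hempty ((hwidth' f).imp fun _ h => h.1)⟩
    refine hempty ⟨0, ?_⟩
    rw [hfacet]
    exact fun f => hF.elim f
  have hP : IsCompressedPresentation a c P m :=
    { nonempty := hne
      eq_convexHull := hlat
      injective := hinj
      latticeVec_mem_iff := henum
      mem_iff := fun x => Set.ext_iff.mp hfacet x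
      dotProduct_le := hwidth }
  exact generatedInDegreeLE_two_of_exchange fun _ hR hcons hexchange A B hcard hsum =>
    hP.rel_of_sum_eq hsing hR hcons hexchange B.card A B hcard rfl hsum
end

section
/- Let ∇ be a compressed lattice polytope with at most one singular vertex. Then the toric ideal I(∇) has a quadratic Gröbner basis; in particular I(∇) is generated in degree two and the semigroup algebra ℂ[S(∇)] is Koszul. -/
open BigOperators Pointwise

/-- A monomial order on the exponent monoid: a linear order compatible with addition
in which `0` is least. -/
def IsMonomialOrder {ι : Type} (r : (ι →₀ ℕ) → (ι →₀ ℕ) → Prop) : Prop :=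
  IsLinearOrder (ι →₀ ℕ) r ∧ (∀ μ, r 0 μ) ∧
    ∀ μ ν τ : ι →₀ ℕ, r μ ν → r (μ + τ) (ν + τ)

/-- `μ` is the leading monomial of the polynomial `p` with respect to the order `r`. -/
def IsLeadingMonomial {ι : Type} (r : (ι →₀ ℕ) → (ι →₀ ℕ) → Prop)
    (p : MvPolynomial ι ℂ) (μ : ι →₀ ℕ) : Prop :=
  μ ∈ p.support ∧ ∀ ν ∈ p.support, r ν μ

/-- `G` is a Gröbner basis of `I` with respect to the monomial order `r`: `G ⊆ I` and
the leading monomial of every nonzero element of `I` is divisible by the leading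
monomial of some element of `G`. -/
def IsGroebnerBasis {ι : Type} (r : (ι →₀ ℕ) → (ι →₀ ℕ) → Prop)
    (G : Finset (MvPolynomial ι ℂ)) (I : Ideal (MvPolynomial ι ℂ)) : Prop :=
  (↑G ⊆ (I : Set (MvPolynomial ι ℂ))) ∧
  ∀ p ∈ I, p ≠ 0 → ∃ g ∈ G, ∃ μg μp : ι →₀ ℕ,
    IsLeadingMonomial r g μg ∧ IsLeadingMonomial r p μp ∧ μg ≤ μp

section Toric

variable {k : ℕ} {M : Type} [AddCommGroup M]

/-- The degree of the monomial `μ` in the fine grading given by the lattice points `m`. -/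
noncomputable def fineDegree (m : Fin k → M) : (Fin k →₀ ℕ) →ₗ[ℕ] M × ℤ :=
  Finsupp.linearCombination ℕ (fun i => ((m i, 1) : M × ℤ))

theorem aeval_single_monomial (m : Fin k → M) (μ : Fin k →₀ ℕ) (z : ℂ) :
    MvPolynomial.aeval (fun i => (AddMonoidAlgebra.single ((m i, 1) : M × ℤ) (1 : ℂ) :
      AddMonoidAlgebra ℂ (M × ℤ))) (MvPolynomial.monomial μ z) =
      AddMonoidAlgebra.single (fineDegree m μ) z := by
  have key : (μ.prod fun i n => (AddMonoidAlgebra.single ((m i, 1) : M × ℤ) (1 : ℂ) :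
      AddMonoidAlgebra ℂ (M × ℤ)) ^ n) = AddMonoidAlgebra.single (fineDegree m μ) 1 := by
    induction μ using Finsupp.induction_linear with
    | zero => simp [AddMonoidAlgebra.one_def]
    | add f g hf hg =>
      rw [Finsupp.prod_add_index' (by simp) (by simp [pow_add]), hf, hg,
        AddMonoidAlgebra.single_mul_single, map_add, one_mul]
    | single a b =>
      rw [Finsupp.prod_single_index (by simp), AddMonoidAlgebra.single_pow, one_pow, fineDegree,
        Finsupp.linearCombination_single]
  rw [MvPolynomial.aeval_monomial, key, ← Algebra.smul_def, AddMonoidAlgebra.smul_single,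
    smul_eq_mul, mul_one]

theorem mem_toricIdeal_iff (m : Fin k → M) (p : MvPolynomial (Fin k) ℂ) :
    p ∈ toricIdeal m ↔ ∑ v ∈ p.support, (AddMonoidAlgebra.single (fineDegree m v) (p.coeff v) :
      AddMonoidAlgebra ℂ (M × ℤ)) = 0 := by
  simp only [← aeval_single_monomial, ← map_sum, MvPolynomial.support_sum_monomial_coeff]
  rfl

theorem sum_coeff_smul_eq_zero {N : Type*} [AddCommGroup N] [Module ℂ N] {m : Fin k → M}
    {p : MvPolynomial (Fin k) ℂ} (hp : p ∈ toricIdeal m) (h : M × ℤ → N) :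
    ∑ v ∈ p.support, p.coeff v • h (fineDegree m v) = 0 := by
  have := congrArg (fun x : AddMonoidAlgebra ℂ (M × ℤ) => Finsupp.linearCombination ℂ h x.coeff)
    ((mem_toricIdeal_iff m p).1 hp)
  simpa [AddMonoidAlgebra.coeff_sum, map_sum, AddMonoidAlgebra.coeff_single] using this

theorem monomial_sub_monomial_mem_toricIdeal {m : Fin k → M} {μ ν : Fin k →₀ ℕ}
    (h : fineDegree m μ = fineDegree m ν) :
    MvPolynomial.monomial μ (1 : ℂ) - MvPolynomial.monomial ν 1 ∈ toricIdeal m := by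
  change MvPolynomial.aeval _ (_ - _) = 0
  rw [map_sub, aeval_single_monomial, aeval_single_monomial, h, sub_self]

/-- The exponents whose support is a chain for the set family `φ`. -/
def IsChainExponent {J : Type*} (φ : Fin k → Finset J) (μ : Fin k →₀ ℕ) : Prop :=
  ∀ i ∈ μ.support, ∀ j ∈ μ.support, φ i ⊆ φ j ∨ φ j ⊆ φ i

theorem IsChainExponent.exists_top {J : Type*} {φ : Fin k → Finset J} {μ : Fin k →₀ ℕ}
    (hμ : IsChainExponent φ μ) (h0 : μ ≠ 0) :
    ∃ i ∈ μ.support, ∀ j ∈ μ.support, φ j ⊆ φ i := by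
  obtain ⟨i, hi, hmax⟩ := Finset.exists_max_image μ.support (fun i => (φ i).card)
    (Finsupp.support_nonempty_iff.2 h0)
  refine ⟨i, hi, fun j hj => ?_⟩
  rcases hμ i hi j hj with h | h
  · exact (Finset.eq_of_subset_of_card_le h (hmax j hj)).ge
  · exact h

/-- The exponent of the product of two variables. -/
noncomputable def pairExponent (a b : Fin k) : Fin k →₀ ℕ :=
  Finsupp.single a 1 + Finsupp.single b 1

theorem exists_pairExponent_le {J : Type*} {φ : Fin k → Finset J} {μ : Fin k →₀ ℕ}
    (h : ¬ IsChainExponent φ μ) :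
    ∃ a b, ¬ φ a ⊆ φ b ∧ ¬ φ b ⊆ φ a ∧ pairExponent a b ≤ μ := by
  unfold IsChainExponent at h
  push Not at h
  obtain ⟨a, ha, b, hb, h₁, h₂⟩ := h
  refine ⟨a, b, h₁, h₂, fun i => ?_⟩
  have hab : a ≠ b := by rintro rfl; exact h₁ subset_rfl
  have ha' : μ a ≠ 0 := by simpa using ha
  have hb' : μ b ≠ 0 := by simpa using hb
  simp only [pairExponent, Finsupp.add_apply, Finsupp.single_apply]
  split_ifs <;> subst_vars <;> first | exact absurd rfl hab | omega

variable {J : Type*} [DecidableEq J]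

theorem snd_fineDegree (m : Fin k → M) (μ : Fin k →₀ ℕ) :
    (fineDegree m μ).2 = (μ.degree : ℤ) := by
  induction μ using Finsupp.induction_linear with
  | zero => simp
  | add f g hf hg => simp [hf, hg]
  | single a b => simp [fineDegree]

theorem apply_fineDegree_pos_iff {m : Fin k → M} {φ : Fin k → Finset J} {j : J}
    {l : M × ℤ →+ ℝ} (hl : ∀ i, l (m i, 1) = if j ∈ φ i then 1 else 0) (μ : Fin k →₀ ℕ) :
    0 < l (fineDegree m μ) ↔ ∃ i ∈ μ.support, j ∈ φ i := by
  have h1 : l (fineDegree m μ) = ∑ i ∈ μ.support, if j ∈ φ i then (μ i : ℝ) else 0 := by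
    simp only [fineDegree, Finsupp.linearCombination_apply, Finsupp.sum, map_sum, map_nsmul, hl]
    refine Finset.sum_congr rfl fun i _ => ?_
    split_ifs <;> simp
  rw [h1, Finset.sum_pos_iff_of_nonneg (fun i _ => by split_ifs <;> positivity)]
  refine exists_congr fun i => and_congr_right fun hi => ?_
  have : μ i ≠ 0 := by simpa using hi
  by_cases hj : j ∈ φ i <;> simp [hj, Nat.pos_of_ne_zero this]

theorem IsChainExponent.eq_of_fineDegree_eq {m : Fin k → M} {φ : Fin k → Finset J}
    (hφ : Function.Injective φ)
    (hlin : ∀ j, ∃ l : M × ℤ →+ ℝ, ∀ i, l (m i, 1) = if j ∈ φ i then 1 else 0) (n : ℕ) :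
    ∀ μ ν : Fin k →₀ ℕ, μ.degree = n → IsChainExponent φ μ → IsChainExponent φ ν →
      fineDegree m μ = fineDegree m ν → μ = ν := by
  induction n with
  | zero =>
    intro μ ν hn _ _ h
    have hν := snd_fineDegree m ν
    rw [← h, snd_fineDegree, hn] at hν
    rw [(Finsupp.degree_eq_zero_iff μ).1 hn, eq_comm, ← Finsupp.degree_eq_zero_iff]
    exact_mod_cast hν.symm
  | succ n ih =>
    intro μ ν hn hμ hν h
    have hn' := snd_fineDegree m ν
    rw [← h, snd_fineDegree, hn] at hn'
    have hμ0 : μ ≠ 0 := by rintro rfl; simp at hn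
    have hν0 : ν ≠ 0 := by
      rintro rfl
      simp at hn'
      omega
    obtain ⟨i, hi, hi'⟩ := hμ.exists_top hμ0
    obtain ⟨i₁, hi₁, hi₁'⟩ := hν.exists_top hν0
    have hii : i = i₁ := by
      apply hφ
      ext j
      obtain ⟨l, hl⟩ := hlin j
      have e := apply_fineDegree_pos_iff hl μ
      rw [h, apply_fineDegree_pos_iff hl ν] at e
      constructor
      · intro hj
        obtain ⟨t, ht, hjt⟩ := e.2 ⟨i, hi, hj⟩
        exact hi₁' t ht hjt
      · intro hj
        obtain ⟨t, ht, hjt⟩ := e.1 ⟨i₁, hi₁, hj⟩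
        exact hi' t ht hjt
    subst hii
    have dec : ∀ ρ : Fin k →₀ ℕ, i ∈ ρ.support → ∃ ρ', ρ = ρ' + Finsupp.single i 1 := by
      intro ρ hρ
      refine ⟨ρ - Finsupp.single i 1, (tsub_add_cancel_of_le ?_).symm⟩
      rw [Finsupp.single_le_iff]
      exact Nat.one_le_iff_ne_zero.2 (by simpa using hρ)
    obtain ⟨μ', rfl⟩ := dec μ hi
    obtain ⟨ν', rfl⟩ := dec ν hi₁
    have sub : ∀ ρ : Fin k →₀ ℕ, IsChainExponent φ (ρ + Finsupp.single i 1) →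
        IsChainExponent φ ρ := by
      intro ρ hρ a ha b hb
      refine hρ a ?_ b ?_ <;> simp at ha hb ⊢ <;> tauto
    rw [ih μ' ν' (by simpa using hn) (sub _ hμ) (sub _ hν) (by simpa using h)]

/-- The weight `∑ i, μ i * (|J| ^ 2 - |φ i| ^ 2)` of an exponent. -/
noncomputable def latticeWeight [Fintype J] (φ : Fin k → Finset J) : (Fin k →₀ ℕ) →ₗ[ℕ] ℕ :=
  Finsupp.linearCombination ℕ (fun i => Fintype.card J ^ 2 - (φ i).card ^ 2)

/-- The monomial order comparing weights first and breaking ties lexicographically. -/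
def weightOrder (W : (Fin k →₀ ℕ) →ₗ[ℕ] ℕ) (μ ν : Fin k →₀ ℕ) : Prop :=
  W μ < W ν ∨ W μ = W ν ∧ toLex μ ≤ toLex ν

theorem isMonomialOrder_weightOrder (W : (Fin k →₀ ℕ) →ₗ[ℕ] ℕ) :
    IsMonomialOrder (weightOrder W) := by
  refine ⟨{ refl := ?_, trans := ?_, antisymm := ?_, total := ?_ }, ?_, ?_⟩
  · intro a
    exact Or.inr ⟨rfl, le_rfl⟩
  · rintro a b c (h | ⟨h, h'⟩) (g | ⟨g, g'⟩)
    · exact Or.inl (h.trans g)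
    · exact Or.inl (g ▸ h)
    · exact Or.inl (h ▸ g)
    · exact Or.inr ⟨h.trans g, h'.trans g'⟩
  · rintro a b (h | ⟨h, h'⟩) (g | ⟨g, g'⟩)
    · omega
    · omega
    · omega
    · exact toLex.injective (le_antisymm h' g')
  · intro a b
    rcases lt_trichotomy (W a) (W b) with h | h | h
    · exact Or.inl (Or.inl h)
    · rcases le_total (toLex a) (toLex b) with g | g
      · exact Or.inl (Or.inr ⟨h, g⟩)
      · exact Or.inr (Or.inr ⟨h.symm, g⟩)
    · exact Or.inr (Or.inl h)
  · intro μ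
    rcases Nat.eq_zero_or_pos (W μ) with h | h
    · refine Or.inr ⟨by simp [h], ?_⟩
      exact Finsupp.toLex_monotone (zero_le : 0 ≤ μ)
    · exact Or.inl (by simpa using h)
  · rintro μ ν τ (h | ⟨h, h'⟩)
    · exact Or.inl (by simpa using h)
    · refine Or.inr ⟨by simpa using h, ?_⟩
      rw [toLex_add, toLex_add]
      gcongr

theorem sq_card_inter_union {A B : Finset J} (h₁ : ¬ A ⊆ B) (h₂ : ¬ B ⊆ A) :
    A.card ^ 2 + B.card ^ 2 < (A ∩ B).card ^ 2 + (A ∪ B).card ^ 2 := by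
  have e := Finset.card_inter_add_card_union A B
  have a : (A ∩ B).card < A.card :=
    Finset.card_lt_card (Finset.ssubset_iff_subset_ne.2
      ⟨Finset.inter_subset_left, fun h => h₁ (Finset.inter_eq_left.1 h)⟩)
  have b : (A ∩ B).card < B.card :=
    Finset.card_lt_card (Finset.ssubset_iff_subset_ne.2
      ⟨Finset.inter_subset_right, fun h => h₂ (Finset.inter_eq_right.1 h)⟩)
  obtain ⟨x, hx⟩ := Nat.exists_eq_add_of_lt a
  obtain ⟨y, hy⟩ := Nat.exists_eq_add_of_lt b
  have hu : (A ∪ B).card = (A ∩ B).card + x + 1 + (y + 1) := by omega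
  rw [hu, hx, hy]
  nlinarith [Nat.zero_le (x * y), Nat.zero_le x, Nat.zero_le y]

theorem latticeWeight_pairExponent_lt [Fintype J] {φ : Fin k → Finset J} {a b c d : Fin k}
    (h₁ : ¬ φ a ⊆ φ b) (h₂ : ¬ φ b ⊆ φ a) (hc : φ c = φ a ∩ φ b) (hd : φ d = φ a ∪ φ b) :
    latticeWeight φ (pairExponent c d) < latticeWeight φ (pairExponent a b) := by
  have h := sq_card_inter_union h₁ h₂
  rw [← hc, ← hd] at h
  have hb : ∀ i, (φ i).card ^ 2 ≤ Fintype.card J ^ 2 := fun i =>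
    Nat.pow_le_pow_left (Finset.card_le_univ _) 2
  have ha := hb a
  have hb' := hb b
  have hc' := hb c
  have hd' := hb d
  simp only [latticeWeight, pairExponent, map_add, Finsupp.linearCombination_single, one_smul]
  omega

theorem fineDegree_pairExponent {m : Fin k → M} {a b c d : Fin k} (h : m a + m b = m c + m d) :
    fineDegree m (pairExponent a b) = fineDegree m (pairExponent c d) := by
  simp [fineDegree, pairExponent, h]

theorem totalDegree_pair_sub_pair_le (a b c d : Fin k) :
    (MvPolynomial.monomial (pairExponent a b) (1 : ℂ) -
      MvPolynomial.monomial (pairExponent c d) 1).totalDegree ≤ 2 := by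
  have h : ∀ a b : Fin k,
      (MvPolynomial.monomial (pairExponent a b) (1 : ℂ)).totalDegree = 2 := by
    intro a b
    rw [MvPolynomial.totalDegree_monomial _ one_ne_zero]
    change Finsupp.degree (pairExponent a b) = 2
    simp [pairExponent]
  refine (MvPolynomial.totalDegree_sub _ _).trans ?_
  rw [h, h, max_self]

/-- The ideal spanned by the elements of `I` of degree at most two. -/
noncomputable def quadraticPart (I : Ideal (MvPolynomial (Fin k) ℂ)) : Ideal (MvPolynomial (Fin k) ℂ) :=
  Ideal.span {p : MvPolynomial (Fin k) ℂ | p ∈ I ∧ p.totalDegree ≤ 2}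

theorem exists_chain_reduction [Fintype J] {m : Fin k → M} {φ : Fin k → Finset J}
    (hlat : ∀ a b, ∃ c d, φ c = φ a ∩ φ b ∧ φ d = φ a ∪ φ b ∧ m a + m b = m c + m d) (n : ℕ) :
    ∀ μ : Fin k →₀ ℕ, latticeWeight φ μ = n → ∃ ν, IsChainExponent φ ν ∧
      fineDegree m ν = fineDegree m μ ∧ (ν = μ ∨ latticeWeight φ ν < latticeWeight φ μ) ∧
      MvPolynomial.monomial μ (1 : ℂ) - MvPolynomial.monomial ν 1 ∈
        quadraticPart (toricIdeal m) := by
  induction n using Nat.strong_induction_on with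
  | _ n ih =>
    intro μ hμ
    by_cases hs : IsChainExponent φ μ
    · exact ⟨μ, hs, rfl, Or.inl rfl, by simp⟩
    obtain ⟨a, b, h₁, h₂, hle⟩ := exists_pairExponent_le hs
    obtain ⟨τ, rfl⟩ := exists_add_of_le hle
    obtain ⟨c, d, hc, hd, hm⟩ := hlat a b
    have hw := latticeWeight_pairExponent_lt h₁ h₂ hc hd
    have hf := fineDegree_pairExponent hm
    obtain ⟨ν, hν, hνf, hνw, hνm⟩ := ih (latticeWeight φ (pairExponent c d + τ))
      (by rw [← hμ, map_add, map_add]; omega) _ rfl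
    refine ⟨ν, hν, by rw [hνf, map_add, map_add, hf], Or.inr ?_, ?_⟩
    · have : latticeWeight φ (pairExponent c d + τ) < latticeWeight φ (pairExponent a b + τ) := by
        rw [map_add, map_add]; omega
      rcases hνw with rfl | h
      · exact this
      · exact h.trans this
    · have hgen : MvPolynomial.monomial (pairExponent a b) (1 : ℂ) -
          MvPolynomial.monomial (pairExponent c d) 1 ∈ quadraticPart (toricIdeal m) :=
        Ideal.subset_span ⟨monomial_sub_monomial_mem_toricIdeal hf,
          totalDegree_pair_sub_pair_le a b c d⟩
      have := add_mem (Ideal.mul_mem_right (MvPolynomial.monomial τ (1 : ℂ)) _ hgen) hνm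
      simpa [sub_mul, MvPolynomial.monomial_mul] using this

/-- If the lattice points `m` are, up to an affine change of coordinates, the indicator vectors
of a family of sets closed under unions and intersections, then the toric ideal of `m` has a
quadratic Gröbner basis and is generated by quadrics. -/
theorem toricIdeal_quadratic_of_setLattice [Fintype J] (m : Fin k → M) (φ : Fin k → Finset J)
    (hφ : Function.Injective φ)
    (hlat : ∀ a b, ∃ c d, φ c = φ a ∩ φ b ∧ φ d = φ a ∪ φ b ∧ m a + m b = m c + m d)
    (hlin : ∀ j, ∃ l : M × ℤ →+ ℝ, ∀ i, l (m i, 1) = if j ∈ φ i then 1 else 0) :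
    (∃ r : (Fin k →₀ ℕ) → (Fin k →₀ ℕ) → Prop, IsMonomialOrder r ∧
      ∃ G : Finset (MvPolynomial (Fin k) ℂ),
        IsGroebnerBasis r G (toricIdeal m) ∧ ∀ g ∈ G, g.totalDegree ≤ 2) ∧
    GeneratedInDegreeLE (toricIdeal m) 2 := by
  classical
  choose nf hnf hnff hnfw hnfm using fun μ => exists_chain_reduction hlat _ μ rfl
  have huniq : ∀ μ ν, IsChainExponent φ ν → fineDegree m μ = fineDegree m ν → nf μ = ν :=
    fun μ ν hν h => IsChainExponent.eq_of_fineDegree_eq hφ hlin _ _ _ rfl (hnf μ) hν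
      ((hnff μ).trans h)
  constructor
  · have hord := isMonomialOrder_weightOrder (latticeWeight φ)
    refine ⟨weightOrder (latticeWeight φ), hord, ?_⟩
    choose mt jn hmt hjn hmj using hlat
    refine ⟨(Finset.univ.filter fun x : Fin k × Fin k => ¬ φ x.1 ⊆ φ x.2 ∧ ¬ φ x.2 ⊆ φ x.1).image
      fun x => MvPolynomial.monomial (pairExponent x.1 x.2) (1 : ℂ) -
        MvPolynomial.monomial (pairExponent (mt x.1 x.2) (jn x.1 x.2)) 1, ⟨?_, ?_⟩, ?_⟩
    · intro g hg
      simp only [Finset.coe_image, Set.mem_image] at hg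
      obtain ⟨x, -, rfl⟩ := hg
      exact monomial_sub_monomial_mem_toricIdeal (fineDegree_pairExponent (hmj _ _))
    · intro p hp hp0
      have hlin' := hord.1
      obtain ⟨μ, hμ, hmax⟩ : ∃ μ ∈ p.support, ∀ ν ∈ p.support,
          weightOrder (latticeWeight φ) ν μ := by
        obtain ⟨μ, hμ, hm⟩ := Finset.exists_max_image p.support
          (fun μ => toLex (latticeWeight φ μ, toLex μ)) (MvPolynomial.support_nonempty.2 hp0)
        refine ⟨μ, hμ, fun ν hν => ?_⟩
        simpa [Prod.Lex.le_iff, weightOrder] using hm ν hν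
      by_cases hs : IsChainExponent φ μ
      · exfalso
        have hsum := sum_coeff_smul_eq_zero hp
          (fun x => if x = fineDegree m μ then (1 : ℂ) else 0)
        rw [Finset.sum_eq_single_of_mem μ hμ] at hsum
        · simp at hsum
          simp [hsum] at hμ
        · intro ν hν hne
          rw [if_neg, smul_zero]
          intro hf
          have hn := huniq ν μ hs hf
          rcases hnfw ν with h | h
          · exact hne (h ▸ hn)
          · rw [hn] at h
            rcases hmax ν hν with h' | h' <;> omega
      · obtain ⟨a, b, h₁, h₂, hle⟩ := exists_pairExponent_le hs
        refine ⟨_, Finset.mem_image.2 ⟨(a, b), by simp [h₁, h₂], rfl⟩, pairExponent a b, μ, ?_,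
          ⟨hμ, hmax⟩, hle⟩
        have hw := latticeWeight_pairExponent_lt h₁ h₂ (hmt a b) (hjn a b)
        have hne : pairExponent (mt a b) (jn a b) ≠ pairExponent a b := by
          intro h
          rw [h] at hw
          exact lt_irrefl _ hw
        constructor
        · rw [MvPolynomial.mem_support_iff]
          simp [MvPolynomial.coeff_monomial, hne]
        · intro ν hν
          have := MvPolynomial.support_sub _ _ _ hν
          simp only [Finset.mem_union, MvPolynomial.mem_support_iff,
            MvPolynomial.coeff_monomial] at this
          by_cases e₁ : pairExponent a b = ν
          · exact Or.inr ⟨by rw [e₁], by rw [e₁]⟩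
          · by_cases e₂ : pairExponent (mt a b) (jn a b) = ν
            · exact Or.inl (e₂ ▸ hw)
            · simp [e₁, e₂] at this
    · intro g hg
      obtain ⟨x, -, rfl⟩ := Finset.mem_image.1 hg
      exact totalDegree_pair_sub_pair_le _ _ _ _
  · apply le_antisymm
    · intro p hp
      change p ∈ quadraticPart (toricIdeal m)
      have hzero : ∑ v ∈ p.support, MvPolynomial.monomial (nf v) (p.coeff v) = 0 := by
        have hsec : ∃ h : M × ℤ → (Fin k →₀ ℕ), ∀ v, h (fineDegree m v) = nf v := by
          refine ⟨fun x => if hx : ∃ v, fineDegree m v = x then nf hx.choose else 0, fun v => ?_⟩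
          have hx : ∃ w, fineDegree m w = fineDegree m v := ⟨v, rfl⟩
          refine (dif_pos hx).trans ?_
          exact huniq _ _ (hnf v) (hx.choose_spec.trans (hnff v).symm)
        obtain ⟨h, hh⟩ := hsec
        have := sum_coeff_smul_eq_zero hp (fun x => MvPolynomial.monomial (h x) (1 : ℂ))
        simpa [hh, MvPolynomial.smul_monomial] using this
      have hexp : p = ∑ v ∈ p.support, MvPolynomial.C (p.coeff v) *
          (MvPolynomial.monomial v 1 - MvPolynomial.monomial (nf v) 1) := by
        simp only [mul_sub, MvPolynomial.C_mul_monomial, mul_one, Finset.sum_sub_distrib, hzero,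
          sub_zero, MvPolynomial.support_sum_monomial_coeff]
      rw [hexp]
      exact sum_mem fun v _ => Ideal.mul_mem_left _ _ (hnfm v)
    · exact Ideal.span_le.2 fun p hp => hp.1

end Toric

section Graph

variable {V : Type*} (G : SimpleGraph V)

/-- `S` is an independent set of vertices of `G`. -/
def IsStable (S : Finset V) : Prop := ∀ a ∈ S, ∀ b ∈ S, ¬ G.Adj a b

/-- The neighbours of `s` form a clique. -/
def IsSimplicial (s : V) : Prop := ∀ a b, G.Adj s a → G.Adj s b → a ≠ b → G.Adj a b

variable {G}

theorem IsSimplicial.eq_of_mem_stable {S : Finset V} (hS : IsStable G S) {j t u : V}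
    (hj : IsSimplicial G j) (ht : t ∈ S) (hu : u ∈ S) (h : t = j ∨ G.Adj j t)
    (h' : u = j ∨ G.Adj j u) : t = u := by
  by_contra hne
  refine hS t ht u hu ?_
  rcases h with rfl | h <;> rcases h' with rfl | h'
  · exact absurd rfl hne
  · exact h'
  · exact h.symm
  · exact hj t u h h' hne

variable [LinearOrder V]

/-- Given two independent sets of simplicial vertices, collect the smaller and the larger elements
of each clique separately. -/
theorem exists_stable_exchange {S T : Finset V} (hS : IsStable G S) (hT : IsStable G T)
    (hS' : ∀ t ∈ S, IsSimplicial G t) (hT' : ∀ t ∈ T, IsSimplicial G t) :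
    ∃ C D : Finset V, IsStable G C ∧ IsStable G D ∧ C ⊆ S ∪ T ∧ D ⊆ S ∪ T ∧
      (∀ t, ((t ∈ S ∧ t ∈ T) ↔ (t ∈ C ∧ t ∈ D)) ∧ ((t ∈ S ∨ t ∈ T) ↔ (t ∈ C ∨ t ∈ D))) ∧
      (∀ j, IsSimplicial G j → ((∃ t ∈ D, j ≤ t ∧ (t = j ∨ G.Adj j t)) ↔
        ((∃ t ∈ S, j ≤ t ∧ (t = j ∨ G.Adj j t)) ∨ ∃ t ∈ T, j ≤ t ∧ (t = j ∨ G.Adj j t)))) ∧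
      (∀ j, IsSimplicial G j → ((∃ t ∈ C, j ≤ t ∧ (t = j ∨ G.Adj j t)) ↔
        ((∃ t ∈ S, j ≤ t ∧ (t = j ∨ G.Adj j t)) ∧ ∃ t ∈ T, j ≤ t ∧ (t = j ∨ G.Adj j t)))) := by
  classical
  have hU : ∀ t ∈ S ∪ T, IsSimplicial G t := by
    intro t ht
    rcases Finset.mem_union.1 ht with h | h
    · exact hS' t h
    · exact hT' t h
  have three : ∀ x ∈ S ∪ T, ∀ y ∈ S ∪ T, ∀ z ∈ S ∪ T,
      ¬ (G.Adj x y ∧ G.Adj y z ∧ G.Adj x z) := by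
    rintro x hx y hy z hz ⟨h₁, h₂, h₃⟩
    simp only [Finset.mem_union] at hx hy hz
    rcases hx with hx | hx <;> rcases hy with hy | hy <;> rcases hz with hz | hz <;>
    first
    | exact hS _ hx _ hy h₁
    | exact hT _ hx _ hy h₁
    | exact hS _ hy _ hz h₂
    | exact hT _ hy _ hz h₂
    | exact hS _ hx _ hz h₃
    | exact hT _ hx _ hz h₃
  have three' : ∀ x ∈ S ∪ T, ∀ y ∈ S ∪ T, ∀ z ∈ S ∪ T, x < y → y < z → G.Adj x y →
      ¬ G.Adj y z := fun x hx y hy z hz h₁ h₂ h₃ h₄ => three x hx y hy z hz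
    ⟨h₃, h₄, hU y hy x z h₃.symm h₄ (h₁.trans h₂).ne⟩
  have trans : ∀ j x y, IsSimplicial G x → j ≤ x → x < y → (x = j ∨ G.Adj j x) → G.Adj x y →
      (y = j ∨ G.Adj j y) := by
    rintro j x y hx hjx hxy (rfl | h) h'
    · exact Or.inr h'
    · exact Or.inr (hx j y h.symm h' (hjx.trans_lt hxy).ne)
  have join : ∀ j x y, IsSimplicial G j → (x = j ∨ G.Adj j x) → (y = j ∨ G.Adj j y) → x ≠ y →
      G.Adj x y := by
    rintro j x y hj (rfl | h) (rfl | h') hne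
    · exact absurd rfl hne
    · exact h'
    · exact h.symm
    · exact hj x y h h' hne
  refine ⟨(S ∩ T) ∪ (S ∪ T).filter (fun i => ∃ i' ∈ S ∪ T, i < i' ∧ G.Adj i i'),
    (S ∪ T).filter (fun i => ∀ i' ∈ S ∪ T, i < i' → ¬ G.Adj i i'), ?_, ?_, ?_, ?_, ?_, ?_, ?_⟩
  · have main : ∀ a ∈ (S ∩ T) ∪ (S ∪ T).filter (fun i => ∃ i' ∈ S ∪ T, i < i' ∧ G.Adj i i'),
        ∀ b ∈ (S ∩ T) ∪ (S ∪ T).filter (fun i => ∃ i' ∈ S ∪ T, i < i' ∧ G.Adj i i'),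
        a < b → ¬ G.Adj a b := by
      intro a ha b hb hlt hab
      have ha' : a ∈ S ∪ T := by grind
      rcases Finset.mem_union.1 hb with h | h
      · rcases Finset.mem_union.1 ha' with h' | h'
        · exact hS _ h' _ (Finset.mem_inter.1 h).1 hab
        · exact hT _ h' _ (Finset.mem_inter.1 h).2 hab
      · obtain ⟨hb', c, hc, hbc, hadj⟩ := Finset.mem_filter.1 h
        exact three' a ha' b hb' c hc hlt hbc hab hadj
    intro a ha b hb hab
    rcases lt_trichotomy a b with h | h | h
    · exact main a ha b hb h hab
    · exact hab.ne h
    · exact main b hb a ha h hab.symm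
  · intro a ha b hb hab
    rw [Finset.mem_filter] at ha hb
    rcases lt_trichotomy a b with h | h | h
    · exact ha.2 b hb.1 h hab
    · exact hab.ne h
    · exact hb.2 a ha.1 h hab.symm
  · grind
  · grind
  · intro t
    have key : t ∈ S → t ∈ T → ∀ i' ∈ S ∪ T, ¬ G.Adj t i' := by
      intro h₁ h₂ i' hi' h
      rcases Finset.mem_union.1 hi' with h' | h'
      · exact hS _ h₁ _ h' h
      · exact hT _ h₂ _ h' h
    simp only [Finset.mem_union, Finset.mem_inter, Finset.mem_filter] at key ⊢
    constructor <;> grind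
  · intro j hj
    constructor
    · rintro ⟨t, ht, h⟩
      rcases Finset.mem_union.1 (Finset.mem_filter.1 ht).1 with h' | h'
      · exact Or.inl ⟨t, h', h⟩
      · exact Or.inr ⟨t, h', h⟩
    · intro h
      obtain ⟨t, ht, hjt, h⟩ : ∃ t ∈ S ∪ T, j ≤ t ∧ (t = j ∨ G.Adj j t) := by
        rcases h with ⟨t, ht, h⟩ | ⟨t, ht, h⟩
        · exact ⟨t, Finset.mem_union_left _ ht, h⟩
        · exact ⟨t, Finset.mem_union_right _ ht, h⟩
      by_cases hmax : ∀ i' ∈ S ∪ T, t < i' → ¬ G.Adj t i'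
      · exact ⟨t, Finset.mem_filter.2 ⟨ht, hmax⟩, hjt, h⟩
      · push Not at hmax
        obtain ⟨u, hu, htu, hadj⟩ := hmax
        exact ⟨u, Finset.mem_filter.2 ⟨hu, fun v hv huv => three' t ht u hu v hv htu huv hadj⟩,
          hjt.trans htu.le, trans j t u (hU t ht) hjt htu h hadj⟩
  · intro j hj
    constructor
    · rintro ⟨t, ht, hjt, h⟩
      rcases Finset.mem_union.1 ht with h' | h'
      · exact ⟨⟨t, (Finset.mem_inter.1 h').1, hjt, h⟩, ⟨t, (Finset.mem_inter.1 h').2, hjt, h⟩⟩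
      · obtain ⟨ht', u, hu, htu, hadj⟩ := Finset.mem_filter.1 h'
        have hju := trans j t u (hU t ht') hjt htu h hadj
        have hle := hjt.trans htu.le
        rcases Finset.mem_union.1 ht' with h₁ | h₁ <;> rcases Finset.mem_union.1 hu with h₂ | h₂
        · exact absurd hadj (hS _ h₁ _ h₂)
        · exact ⟨⟨t, h₁, hjt, h⟩, ⟨u, h₂, hle, hju⟩⟩
        · exact ⟨⟨u, h₂, hle, hju⟩, ⟨t, h₁, hjt, h⟩⟩
        · exact absurd hadj (hT _ h₁ _ h₂)
    · rintro ⟨⟨t, ht, hjt, h⟩, ⟨u, hu, hju, h'⟩⟩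
      rcases lt_trichotomy t u with hlt | rfl | hlt
      · exact ⟨t, Finset.mem_union_right _ (Finset.mem_filter.2 ⟨Finset.mem_union_left _ ht, u,
          Finset.mem_union_right _ hu, hlt, join j t u hj h h' hlt.ne⟩), hjt, h⟩
      · exact ⟨t, Finset.mem_union_left _ (Finset.mem_inter.2 ⟨ht, hu⟩), hjt, h⟩
      · exact ⟨u, Finset.mem_union_right _ (Finset.mem_filter.2 ⟨Finset.mem_union_right _ hu, t,
          Finset.mem_union_left _ ht, hlt, join j u t hj h' h hlt.ne⟩), hju, h'⟩

open Classical in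
/-- The order ideal attached to a stable set. Every clique of simplicial vertices is viewed as a
chain; the non-simplicial vertices record whether they are absent. -/
noncomputable def stableIdeal [Fintype V] (G : SimpleGraph V) (S : Finset V) : Finset V :=
  Finset.univ.filter fun j =>
    (IsSimplicial G j ∧ ∃ t ∈ S, (j ≤ t ∧ (t = j ∨ G.Adj j t)) ∧ IsSimplicial G t) ∨
      (¬ IsSimplicial G j ∧ j ∉ S)

variable [Fintype V]

theorem mem_stableIdeal_of_simplicial {S : Finset V} {j : V} (hj : IsSimplicial G j) :
    j ∈ stableIdeal G S ↔ ∃ t ∈ S, (j ≤ t ∧ (t = j ∨ G.Adj j t)) ∧ IsSimplicial G t := by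
  simp [stableIdeal, hj]

theorem mem_stableIdeal_of_not_simplicial {S : Finset V} {j : V} (hj : ¬ IsSimplicial G j) :
    j ∈ stableIdeal G S ↔ j ∉ S := by
  simp [stableIdeal, hj]

theorem stableIdeal_injOn {S T : Finset V} (hS : IsStable G S) (hT : IsStable G T)
    (h : stableIdeal G S = stableIdeal G T) : S = T := by
  have main : ∀ {S T : Finset V}, IsStable G S → IsStable G T →
      stableIdeal G S = stableIdeal G T → S ⊆ T := by
    intro S T hS hT h i hi
    have hiff : ∀ j, j ∈ stableIdeal G S ↔ j ∈ stableIdeal G T := fun j => by rw [h]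
    by_cases hs : IsSimplicial G i
    · obtain ⟨t, ht, ⟨hit, hadj⟩, hts⟩ := (mem_stableIdeal_of_simplicial hs).1 ((hiff i).1
        ((mem_stableIdeal_of_simplicial hs).2 ⟨i, hi, ⟨le_rfl, Or.inl rfl⟩, hs⟩))
      obtain ⟨u, hu, ⟨htu, hadj'⟩, -⟩ := (mem_stableIdeal_of_simplicial hts).1 ((hiff t).2
        ((mem_stableIdeal_of_simplicial hts).2 ⟨t, ht, ⟨le_rfl, Or.inl rfl⟩, hts⟩))
      have hiu : i = u := hts.eq_of_mem_stable hS hi hu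
        (hadj.imp Eq.symm SimpleGraph.Adj.symm) hadj'
      rw [le_antisymm hit (hiu ▸ htu)]
      exact ht
    · by_contra hi'
      exact (mem_stableIdeal_of_not_simplicial hs).1 ((hiff i).2
        ((mem_stableIdeal_of_not_simplicial hs).2 hi')) hi
  exact (main hS hT h).antisymm (main hT hS h.symm)

theorem stableIdeal_eq_empty {S : Finset V} (hS : IsStable G S)
    (hG : ∀ s, ¬ IsSimplicial G s → ∀ t, t ≠ s → G.Adj s t ∧ IsSimplicial G t)
    {n : V} (hn : n ∈ S) (hns : ¬ IsSimplicial G n) : stableIdeal G S = ∅ := by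
  have hall : ∀ t ∈ S, t = n := by
    intro t ht
    by_contra hne
    exact hS n hn t ht (hG n hns t hne).1
  rw [Finset.eq_empty_iff_forall_notMem]
  intro j hj
  by_cases hs : IsSimplicial G j
  · obtain ⟨t, ht, -, hts⟩ := (mem_stableIdeal_of_simplicial hs).1 hj
    exact hns (hall t ht ▸ hts)
  · have hjS := (mem_stableIdeal_of_not_simplicial hs).1 hj
    have hne : j ≠ n := by rintro rfl; exact hjS hn
    exact hs (hG n hns j hne).2

theorem exists_stableIdeal_lattice
    (hG : ∀ s, ¬ IsSimplicial G s → ∀ t, t ≠ s → G.Adj s t ∧ IsSimplicial G t)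
    {S T : Finset V} (hS : IsStable G S) (hT : IsStable G T) :
    ∃ C D : Finset V, IsStable G C ∧ IsStable G D ∧
      stableIdeal G C = stableIdeal G S ∩ stableIdeal G T ∧
      stableIdeal G D = stableIdeal G S ∪ stableIdeal G T ∧
      (∀ t, ((t ∈ S ∧ t ∈ T) ↔ (t ∈ C ∧ t ∈ D)) ∧ ((t ∈ S ∨ t ∈ T) ↔ (t ∈ C ∨ t ∈ D))) := by
  by_cases hS' : ∀ t ∈ S, IsSimplicial G t
  swap
  · push Not at hS'
    obtain ⟨n, hn, hns⟩ := hS'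
    refine ⟨S, T, hS, hT, ?_, ?_, fun t => ⟨Iff.rfl, Iff.rfl⟩⟩ <;>
      simp [stableIdeal_eq_empty hS hG hn hns]
  by_cases hT' : ∀ t ∈ T, IsSimplicial G t
  swap
  · push Not at hT'
    obtain ⟨n, hn, hns⟩ := hT'
    refine ⟨T, S, hT, hS, ?_, ?_, fun t => ⟨and_comm, or_comm⟩⟩ <;>
      simp [stableIdeal_eq_empty hT hG hn hns]
  obtain ⟨C, D, hC, hD, hCU, hDU, hmem, hj, hm⟩ := exists_stable_exchange hS hT hS' hT'
  refine ⟨C, D, hC, hD, ?_, ?_, hmem⟩ <;> ext j <;> by_cases hs : IsSimplicial G j <;>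
    simp only [Finset.mem_inter, Finset.mem_union, mem_stableIdeal_of_simplicial,
      mem_stableIdeal_of_not_simplicial, hs, not_false_eq_true]
  · have := hm j hs
    grind
  · grind
  · have := hj j hs
    grind
  · grind

/-- The toric ideal of the stable sets of a graph in which every non-simplicial vertex is adjacent
to all other vertices and all these are simplicial. -/
theorem toricIdeal_quadratic_of_stableSets {k : ℕ} {M : Type} [AddCommGroup M] (m : Fin k → M)
    (hG : ∀ s, ¬ IsSimplicial G s → ∀ t, t ≠ s → G.Adj s t ∧ IsSimplicial G t)
    (w : M) (g : V → M) (S : Fin k → Finset V) (hS : ∀ i, IsStable G (S i))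
    (hm : ∀ i, m i = w + ∑ j ∈ S i, g j) (hinj : Function.Injective m)
    (hsurj : ∀ T, IsStable G T → ∃ i, m i = w + ∑ j ∈ T, g j)
    (hlin : ∀ j, ∃ l : M × ℤ →+ ℝ, ∀ T : Finset V, l (w + ∑ j ∈ T, g j, 1) =
      if j ∈ T then 1 else 0) :
    (∃ r : (Fin k →₀ ℕ) → (Fin k →₀ ℕ) → Prop, IsMonomialOrder r ∧
      ∃ G : Finset (MvPolynomial (Fin k) ℂ),
        IsGroebnerBasis r G (toricIdeal m) ∧ ∀ g ∈ G, g.totalDegree ≤ 2) ∧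
    GeneratedInDegreeLE (toricIdeal m) 2 := by
  classical
  choose l hl using hlin
  have huniq : ∀ T T' : Finset V, w + ∑ j ∈ T, g j = w + ∑ j ∈ T', g j → T = T' := by
    intro T T' h
    ext j
    have h₁ := hl j T
    rw [h, hl j T'] at h₁
    by_cases hT : j ∈ T <;> by_cases hT' : j ∈ T' <;> simp_all
  have hSinj : ∀ a b, S a = S b → a = b := fun a b h => hinj (by rw [hm, hm, h])
  have hsurj' : ∀ T, IsStable G T → ∃ i, S i = T := fun T hT => by
    obtain ⟨i, hi⟩ := hsurj T hT
    exact ⟨i, huniq _ _ ((hm i).symm.trans hi)⟩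
  refine toricIdeal_quadratic_of_setLattice m (fun i => stableIdeal G (S i))
    (fun a b h => hSinj a b (stableIdeal_injOn (hS a) (hS b) h)) ?_ ?_
  · intro a b
    obtain ⟨C, D, hC, hD, hCe, hDe, hmem⟩ := exists_stableIdeal_lattice hG (hS a) (hS b)
    obtain ⟨c, rfl⟩ := hsurj' C hC
    obtain ⟨e, rfl⟩ := hsurj' D hD
    refine ⟨c, e, hCe, hDe, ?_⟩
    have hsum : ∑ j ∈ S a, g j + ∑ j ∈ S b, g j = ∑ j ∈ S c, g j + ∑ j ∈ S e, g j := by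
      rw [← Finset.sum_union_inter, ← Finset.sum_union_inter (s₁ := S c)]
      congr 2 <;> ext t <;> simp [hmem t]
    rw [hm a, hm b, hm c, hm e, add_add_add_comm, hsum, add_add_add_comm]
  · intro j
    by_cases hs : IsSimplicial G j
    · refine ⟨∑ t ∈ Finset.univ.filter
        (fun t => (j ≤ t ∧ (t = j ∨ G.Adj j t)) ∧ IsSimplicial G t), l t, fun i => ?_⟩
      rw [AddMonoidHom.finsetSum_apply, hm i]
      simp only [hl, mem_stableIdeal_of_simplicial hs]
      split_ifs with h
      · obtain ⟨t, ht, h⟩ := h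
        rw [Finset.sum_eq_single_of_mem t (by simpa using h)]
        · simp [ht]
        · intro u hu hne
          rw [if_neg]
          intro hu'
          simp only [Finset.mem_filter] at hu
          exact hne (hs.eq_of_mem_stable (hS i) hu' ht hu.2.1.2 h.1.2)
      · refine Finset.sum_eq_zero fun t ht => if_neg fun ht' => h ⟨t, ht', ?_⟩
        simpa using ht
    · refine ⟨(Int.castAddHom ℝ).comp (AddMonoidHom.snd M ℤ) - l j, fun i => ?_⟩
      rw [AddMonoidHom.sub_apply, hm i, hl]
      simp only [mem_stableIdeal_of_not_simplicial hs]
      by_cases h : j ∈ S i <;> simp [h]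

end Graph

section Polytope

/-- The inclusion of lattice points into real space. -/
def intPoint (d : ℕ) : (Fin d → ℤ) →+ (Fin d → ℝ) where
  toFun v i := v i
  map_zero' := by ext; simp
  map_add' _ _ := by ext; simp

theorem intPoint_zsmul {d : ℕ} (z : ℤ) (p : Fin d → ℤ) :
    intPoint d (z • p) = (z : ℝ) • intPoint d p := by
  ext
  simp [intPoint]

theorem intPoint_nsmul {d : ℕ} (n : ℕ) (p : Fin d → ℤ) :
    intPoint d (n • p) = (n : ℝ) • intPoint d p := by
  ext
  simp [intPoint]

/-- The linear form on real space given by an integral covector. -/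
noncomputable def intForm {d : ℕ} (a : Fin d → ℤ) : (Fin d → ℝ) →ₗ[ℝ] ℝ :=
  Fintype.linearCombination ℝ (fun i => (a i : ℝ))

theorem intForm_intPoint {d : ℕ} (a p : Fin d → ℤ) :
    intForm a (intPoint d p) = ((∑ i, p i * a i : ℤ) : ℝ) := by
  simp [intForm, intPoint, Fintype.linearCombination_apply]

theorem LinearIndependent.exists_dual {E ι : Type*} [AddCommGroup E] [Module ℝ E] [DecidableEq ι]
    {v : ι → E} (hv : LinearIndependent ℝ v) :
    ∃ l : ι → E →ₗ[ℝ] ℝ, ∀ i j, l i (v j) = if i = j then 1 else 0 := by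
  choose l hl using fun i => LinearMap.exists_extend ((Module.Basis.span hv).coord i)
  refine ⟨l, fun i j => ?_⟩
  have h := LinearMap.congr_fun (hl i) (Module.Basis.span hv j)
  rw [Module.Basis.coord_apply, Module.Basis.repr_self, Finsupp.single_apply] at h
  rw [LinearMap.comp_apply, Submodule.subtype_apply, Module.Basis.span_apply] at h
  simpa [eq_comm] using h

/-- Distinct indices are adjacent if some set of the family contains both. -/
def coverGraph {F V : Type*} (B : F → Finset V) : SimpleGraph V where
  Adj a b := a ≠ b ∧ ∃ f, a ∈ B f ∧ b ∈ B f
  symm := ⟨fun _ _ h => ⟨h.1.symm, h.2.imp fun _ h => h.symm⟩⟩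
  loopless := ⟨fun _ h => h.1 rfl⟩

theorem IsStable.card_inter_le_one {F V : Type*} [DecidableEq V] {B : F → Finset V}
    {S : Finset V} (hS : IsStable (coverGraph B) S) (f : F) : (B f ∩ S).card ≤ 1 := by
  refine Finset.card_le_one.2 fun x hx y hy => ?_
  rw [Finset.mem_inter] at hx hy
  by_contra hne
  exact hS x hx.2 y hy.2 ⟨hne, f, hx.1, hy.1⟩

/-- The tangent cone of `P` at `v`. -/
def polytopeConeAt {d : ℕ} (P : Set (Fin d → ℝ)) (v : Fin d → ℝ) : Set (Fin d → ℝ) :=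
  {y | ∃ s : ℝ, 0 ≤ s ∧ ∃ x ∈ P, y = s • (x - v)}

/-- Unimodular coordinates `l` at a vertex `w` of `P`, dual to lattice vectors `g`, in which the
lattice points `m` of `P` are the indicator vectors of the stable sets of `coverGraph B`. -/
structure StableCoordinates {d : ℕ} {F : Type} (P : Set (Fin d → ℝ)) {k : ℕ}
    (m : Fin k → Fin d → ℤ) (w : Fin d → ℤ) (r : ℕ) where
  /-- the edge vectors at `w` -/
  g : Fin r → Fin d → ℤ
  /-- the dual coordinates -/
  l : Fin r → (Fin d → ℝ) →ₗ[ℝ] ℝ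
  /-- the coordinates occurring in each facet inequality -/
  B : F → Finset (Fin r)
  dual : ∀ i j, l i (intPoint d (g j)) = if i = j then 1 else 0
  nonneg : ∀ x ∈ P, ∀ j, 0 ≤ l j (x - intPoint d w)
  sum_le : ∀ x ∈ P, ∀ f, ∑ j ∈ B f, l j (x - intPoint d w) ≤ 1
  exists_stable : ∀ i, ∃ S, IsStable (coverGraph B) S ∧ m i = w + ∑ j ∈ S, g j
  of_stable : ∀ S, IsStable (coverGraph B) S → ∃ i, m i = w + ∑ j ∈ S, g j

/-- A lattice polytope all of whose facets have width one admits stable coordinates at each of its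
smooth vertices. -/
theorem exists_stableCoordinates {d : ℕ} {F : Type} {a : F → Fin d → ℤ} {c : F → ℤ}
    {P : Set (Fin d → ℝ)} {k : ℕ} {m : Fin k → Fin d → ℤ}
    (hlat : P = convexHull ℝ (Set.range fun j => intPoint d (m j)))
    (henum : ∀ p : Fin d → ℤ, intPoint d p ∈ P ↔ p ∈ Set.range m)
    (hfacet : ∀ x, x ∈ P ↔ ∀ f, (c f : ℝ) ≤ intForm (a f) x)
    (hwidth : ∀ f, ∀ x ∈ P, intForm (a f) x ≤ c f + 1)
    {w : Fin d → ℤ} (hw : intPoint d w ∈ P) (hsm : IsSmoothVertexOf P w) :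
    ∃ r, Nonempty (StableCoordinates (F := F) P m w r) := by
  classical
  obtain ⟨r, g, hli, hcone, hspan⟩ := hsm
  change LinearIndependent ℝ (fun j => intPoint d (g j)) at hli
  change polytopeConeAt P (intPoint d w) = {y | ∃ lam : Fin r → ℝ, (∀ j, 0 ≤ lam j) ∧
    y = ∑ j, lam j • intPoint d (g j)} at hcone
  change ∀ p : Fin d → ℤ, intPoint d p ∈ Submodule.span ℝ
    (Set.range fun j => intPoint d (g j)) → _ at hspan
  obtain ⟨l, hl⟩ := hli.exists_dual
  have hlsum : ∀ (y : Fin r → ℝ) i, l i (∑ j, y j • intPoint d (g j)) = y i := by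
    intro y i
    simp [map_sum, hl]
  have hcoord : ∀ x ∈ P, (∀ j, 0 ≤ l j (x - intPoint d w)) ∧
      x - intPoint d w = ∑ j, l j (x - intPoint d w) • intPoint d (g j) := by
    intro x hx
    have hxc : x - intPoint d w ∈ polytopeConeAt P (intPoint d w) :=
      ⟨1, zero_le_one, x, hx, (one_smul _ _).symm⟩
    rw [hcone] at hxc
    obtain ⟨lam, hlam, e⟩ := hxc
    rw [e]
    exact ⟨fun j => by rw [hlsum]; exact hlam j, by simp only [hlsum]⟩
  have hmP : ∀ i, intPoint d (m i) ∈ P := fun i => (henum _).2 ⟨i, rfl⟩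
  have hz : ∀ i, ∃ z : Fin r → ℤ, m i = w + ∑ j, z j • g j ∧
      ∀ j, l j (intPoint d (m i) - intPoint d w) = z j := by
    intro i
    obtain ⟨z, hz⟩ := hspan (m i - w) (by
      rw [map_sub, (hcoord _ (hmP i)).2]
      exact Submodule.sum_mem _ fun j _ =>
        Submodule.smul_mem _ _ (Submodule.subset_span ⟨j, rfl⟩))
    refine ⟨z, by rw [← hz]; abel, fun j => ?_⟩
    rw [← map_sub, hz, map_sum, ← hlsum (fun j => (z j : ℝ)) j]
    simp only [intPoint_zsmul]
  choose z hmz hlz using hz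
  have hz0 : ∀ i j, 0 ≤ z i j := fun i j => by
    have := (hcoord _ (hmP i)).1 j
    rw [hlz] at this
    exact_mod_cast this
  have hPconv : Convex ℝ P := hlat ▸ convex_convexHull ℝ _
  have hedge : ∀ j, intPoint d w + intPoint d (g j) ∈ P := by
    intro j
    obtain ⟨i, hi, hi'⟩ : ∃ i, 0 < z i j ∧ ∀ j', j' ≠ j → z i j' = 0 := by
      by_contra! hcon
      let L : (Fin d → ℝ) →ₗ[ℝ] ℝ := ∑ j' ∈ Finset.univ.erase j, l j'
      let K : ℝ := ∑ i, (z i j : ℝ)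
      have hhalf : P ⊆ {x | (l j - K • L) x ≤ (l j - K • L) (intPoint d w)} := by
        rw [hlat]
        refine convexHull_min ?_ (convex_halfSpace_le (l j - K • L).isLinear _)
        rintro _ ⟨i, rfl⟩
        change (l j - K • L) (intPoint d (m i)) ≤ (l j - K • L) (intPoint d w)
        rw [← sub_nonpos, ← map_sub]
        have hL : L (intPoint d (m i) - intPoint d w) =
            ∑ j' ∈ Finset.univ.erase j, (z i j' : ℝ) := by
          simp [L, LinearMap.sum_apply, hlz]
        simp only [LinearMap.sub_apply, LinearMap.smul_apply, smul_eq_mul, hL, hlz]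
        have hK : (z i j : ℝ) ≤ K :=
          Finset.single_le_sum (f := fun i => (z i j : ℝ))
            (fun i _ => by exact_mod_cast hz0 i j) (Finset.mem_univ i)
        have hK0 : (0 : ℝ) ≤ z i j := by exact_mod_cast hz0 i j
        have hnn : (0 : ℝ) ≤ ∑ j' ∈ Finset.univ.erase j, (z i j' : ℝ) :=
          Finset.sum_nonneg fun j' _ => by exact_mod_cast hz0 i j'
        rcases (hz0 i j).eq_or_lt with h0 | h0
        · rw [← h0]
          have := mul_nonneg (hK0.trans hK) hnn
          push_cast
          linarith
        · obtain ⟨j', hne, hj'⟩ := hcon i h0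
          have h1 : (1 : ℝ) ≤ ∑ j' ∈ Finset.univ.erase j, (z i j' : ℝ) := by
            refine le_trans ?_ (Finset.single_le_sum (f := fun j' => (z i j' : ℝ))
              (fun j' _ => by exact_mod_cast hz0 i j')
              (Finset.mem_erase.2 ⟨hne, Finset.mem_univ j'⟩))
            exact_mod_cast (hz0 i j').lt_of_ne' hj'
          nlinarith
      have hg : intPoint d (g j) ∈ polytopeConeAt P (intPoint d w) := by
        rw [hcone]
        exact ⟨fun j' => if j' = j then 1 else 0, fun j' => by dsimp only; split_ifs <;> norm_num, by simp⟩
      obtain ⟨s, hs, x, hx, e⟩ := hg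
      have h1 := hhalf hx
      change (l j - K • L) x ≤ (l j - K • L) (intPoint d w) at h1
      rw [← sub_nonpos, ← map_sub] at h1
      have h2 : (l j - K • L) (intPoint d (g j)) = 1 := by
        simp only [LinearMap.sub_apply, LinearMap.smul_apply, L, LinearMap.sum_apply, hl]
        rw [Finset.sum_eq_zero]
        · simp
        · intro j' hj'
          rw [if_neg (Finset.ne_of_mem_erase hj')]
      rw [e, map_smul, smul_eq_mul] at h2
      nlinarith
    have hm' : intPoint d (m i) = intPoint d w + (z i j : ℝ) • intPoint d (g j) := by
      rw [hmz i, Finset.sum_eq_single j (fun j' _ h => by rw [hi' j' h, zero_smul]) (by simp),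
        map_add, intPoint_zsmul]
    have hpos : (1 : ℝ) ≤ z i j := by exact_mod_cast hi
    have := hPconv.add_smul_mem hw (hm' ▸ hmP i) (t := (z i j : ℝ)⁻¹)
      ⟨by positivity, inv_le_one_of_one_le₀ hpos⟩
    rwa [smul_smul, inv_mul_cancel₀ (by positivity), one_smul] at this
  let B : F → Finset (Fin r) := fun f =>
    Finset.univ.filter fun j => (∑ i, g j i * a f i : ℤ) ≠ 0
  have hform : ∀ f, (intForm (a f) (intPoint d w) = c f ∧
        ∀ y : Fin r → ℝ, intForm (a f) (∑ j, y j • intPoint d (g j)) = ∑ j ∈ B f, y j) ∨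
      (intForm (a f) (intPoint d w) = c f + 1 ∧
        ∀ y : Fin r → ℝ, intForm (a f) (∑ j, y j • intPoint d (g j)) = - ∑ j ∈ B f, y j) := by
    intro f
    have h1 := (hfacet _).1 hw f
    have h2 := hwidth f _ hw
    have h3 : ∀ j, c f ≤ (∑ i, w i * a f i) + ∑ i, g j i * a f i ∧
        (∑ i, w i * a f i) + ∑ i, g j i * a f i ≤ c f + 1 := by
      intro j
      have h3 := (hfacet _).1 (hedge j) f
      have h4 := hwidth f _ (hedge j)
      rw [map_add, intForm_intPoint, intForm_intPoint] at h3 h4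
      exact_mod_cast And.intro h3 h4
    rw [intForm_intPoint] at h1 h2 ⊢
    norm_cast at h1 h2
    simp only [map_sum, map_smul, intForm_intPoint, smul_eq_mul]
    rcases (by omega : (∑ i, w i * a f i) = c f ∨ (∑ i, w i * a f i) = c f + 1) with h | h
    · refine Or.inl ⟨by exact_mod_cast h, fun y => ?_⟩
      rw [Finset.sum_filter]
      refine Finset.sum_congr rfl fun j _ => ?_
      have := h3 j
      rcases (by omega : (∑ i, g j i * a f i) = 0 ∨ (∑ i, g j i * a f i) = 1) with h' | h' <;>
        simp [h']
    · refine Or.inr ⟨by exact_mod_cast h, fun y => ?_⟩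
      rw [Finset.sum_filter, ← Finset.sum_neg_distrib]
      refine Finset.sum_congr rfl fun j _ => ?_
      have := h3 j
      rcases (by omega : (∑ i, g j i * a f i) = 0 ∨ (∑ i, g j i * a f i) = -1) with h' | h' <;>
        simp [h']
  have hle : ∀ x ∈ P, ∀ f, ∑ j ∈ B f, l j (x - intPoint d w) ≤ 1 := by
    intro x hx f
    have e : x = intPoint d w + ∑ j, l j (x - intPoint d w) • intPoint d (g j) := by
      rw [← (hcoord x hx).2]; abel
    have h1 := (hfacet x).1 hx f
    have h2 := hwidth f x hx
    rw [e, map_add] at h1 h2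
    rcases hform f with ⟨h, h'⟩ | ⟨h, h'⟩ <;> rw [h, h'] at h1 h2 <;> linarith
  have hmem : ∀ y : Fin r → ℝ, (∀ j, 0 ≤ y j) → (∀ f, ∑ j ∈ B f, y j ≤ 1) →
      intPoint d w + ∑ j, y j • intPoint d (g j) ∈ P := by
    intro y hy hy'
    rw [hfacet]
    intro f
    have h0 : 0 ≤ ∑ j ∈ B f, y j := Finset.sum_nonneg fun j _ => hy j
    have h1 := hy' f
    rw [map_add]
    rcases hform f with ⟨h, h'⟩ | ⟨h, h'⟩ <;> rw [h, h'] <;> linarith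
  have hcover : ∀ j, ∃ f, j ∈ B f := by
    intro j
    by_contra! hcon
    have hinj : Function.Injective fun n : ℕ => w + n • g j := by
      intro n n' h
      have := congrArg (fun p => l j (intPoint d p)) h
      simpa only [map_add, intPoint_nsmul, map_smul, hl, if_true, smul_eq_mul, mul_one,
        add_right_inj, Nat.cast_inj] using this
    refine Set.infinite_range_of_injective hinj ((Set.finite_range m).subset ?_)
    rintro _ ⟨n, rfl⟩
    rw [← henum, map_add, intPoint_nsmul]
    have := hmem (fun j' => if j' = j then (n : ℝ) else 0) (fun j' => by split_ifs <;> positivity)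
      (fun f => by
        rw [Finset.sum_eq_zero fun j' hj' => if_neg (by rintro rfl; exact hcon f hj')]
        exact zero_le_one)
    simpa using this
  refine ⟨r, ⟨g, l, B, hl, fun x hx => (hcoord x hx).1, hle, fun i => ?_, fun S hS => ?_⟩⟩
  · have hzle : ∀ f, ∑ j ∈ B f, z i j ≤ 1 := by
      intro f
      have := hle _ (hmP i) f
      simp only [hlz] at this
      exact_mod_cast this
    have hz1 : ∀ j, z i j ≤ 1 := by
      intro j
      obtain ⟨f, hf⟩ := hcover j
      exact (Finset.single_le_sum (f := fun j => z i j) (fun j _ => hz0 i j) hf).trans (hzle f)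
    refine ⟨Finset.univ.filter fun j => z i j = 1, ?_, ?_⟩
    · rintro x hx y hy ⟨hne, f, hxf, hyf⟩
      have h := (Finset.sum_le_sum_of_subset_of_nonneg
        (show ({x, y} : Finset (Fin r)) ⊆ B f by
          intro t ht
          rcases Finset.mem_insert.1 ht with rfl | ht
          · exact hxf
          · rwa [Finset.mem_singleton.1 ht])
        (fun j _ _ => hz0 i j)).trans (hzle f)
      rw [Finset.sum_pair hne] at h
      simp only [Finset.mem_filter] at hx hy
      omega
    · rw [hmz i, Finset.sum_filter]
      congr 1
      refine Finset.sum_congr rfl fun j _ => ?_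
      have h0 := hz0 i j
      have h1 := hz1 j
      rcases (by omega : z i j = 0 ∨ z i j = 1) with h | h <;> simp [h]
  · have := hmem (fun j => if j ∈ S then 1 else 0) (fun j => by split_ifs <;> norm_num)
      (fun f => by
        rw [Finset.sum_boole, Finset.filter_mem_eq_inter]
        exact_mod_cast hS.card_inter_le_one f)
    have e : intPoint d w + ∑ j, (if j ∈ S then (1 : ℝ) else 0) • intPoint d (g j) =
        intPoint d (w + ∑ j ∈ S, g j) := by
      simp
    rw [e, henum] at this
    exact this

namespace StableCoordinates

variable {d : ℕ} {F : Type} {P : Set (Fin d → ℝ)} {k : ℕ} {m : Fin k → Fin d → ℤ}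
  {w : Fin d → ℤ} {r : ℕ} (C : StableCoordinates (F := F) P m w r)

/-- The lattice point attached to a set of coordinates. -/
def point (S : Finset (Fin r)) : Fin d → ℤ := w + ∑ j ∈ S, C.g j

theorem l_sub_point (x : Fin d → ℝ) (S : Finset (Fin r)) (j : Fin r) :
    C.l j (x - intPoint d (C.point S)) =
      C.l j (x - intPoint d w) - if j ∈ S then 1 else 0 := by
  simp [point, map_sub, C.dual, sub_add_eq_sub_sub]

theorem l_point_sub (S T : Finset (Fin r)) (j : Fin r) :
    C.l j (intPoint d (C.point T) - intPoint d (C.point S)) =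
      (if j ∈ T then 1 else 0) - if j ∈ S then 1 else 0 := by
  rw [l_sub_point]
  simp [point, C.dual]

theorem point_injective : Function.Injective C.point := by
  intro S T h
  ext j
  have := C.l_point_sub S T j
  rw [h, sub_self, map_zero] at this
  by_cases hS : j ∈ S <;> by_cases hT : j ∈ T <;> simp_all

theorem sum_l_nonpos {S : Finset (Fin r)} {y : Fin d → ℝ}
    (hy : y ∈ polytopeConeAt P (intPoint d (C.point S))) {s : Fin r} (hs : s ∈ S) {f : F}
    (hf : s ∈ C.B f) : ∑ j ∈ C.B f, C.l j y ≤ 0 := by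
  obtain ⟨t, ht, x, hx, rfl⟩ := hy
  simp only [map_smul, smul_eq_mul, ← Finset.mul_sum, l_sub_point, Finset.sum_sub_distrib]
  have h1 := C.sum_le x hx f
  have h2 : (1 : ℝ) ≤ ∑ j ∈ C.B f, if j ∈ S then 1 else 0 := by
    refine le_trans ?_ (Finset.single_le_sum (f := fun j => if j ∈ S then (1 : ℝ) else 0)
      (fun j _ => by positivity) hf)
    simp [hs]
  exact mul_nonpos_of_nonneg_of_nonpos ht (by linarith)

theorem l_nonneg {S : Finset (Fin r)} {y : Fin d → ℝ}
    (hy : y ∈ polytopeConeAt P (intPoint d (C.point S))) {j : Fin r} (hj : j ∉ S) :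
    0 ≤ C.l j y := by
  obtain ⟨t, ht, x, hx, rfl⟩ := hy
  rw [map_smul, l_sub_point, if_neg hj, sub_zero]
  exact mul_nonneg ht (C.nonneg x hx j)

/-- In the edge direction of the tangent cone exchanging `a` for its neighbours, only multiples of
this edge occur; here only the sign of the coordinate of a neighbour `s` is recorded. -/
theorem l_nonneg_of_adj {S T : Finset (Fin r)} (hS : IsStable (coverGraph C.B) S) {s a : Fin r}
    (hs : s ∈ S) (hsa : (coverGraph C.B).Adj s a) (ha : a ∈ T) (hT : ∀ j ∈ T, j = a ∨ j ∈ S)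
    {y : Fin d → ℝ} (hy : y ∈ polytopeConeAt P (intPoint d (C.point S)))
    (hy' : intPoint d (C.point T) - intPoint d (C.point S) - y ∈
      polytopeConeAt P (intPoint d (C.point S))) (hya : C.l a y = 0) : 0 ≤ C.l s y := by
  obtain ⟨hne, f, hsf, haf⟩ := hsa
  have hout : ∀ j ∉ S, C.l j y = 0 := by
    intro j hj
    by_cases hja : j = a
    · rw [hja, hya]
    · have h1 := C.l_nonneg hy hj
      have h2 := C.l_nonneg hy' hj
      have hjT : j ∉ T := fun h => (hT j h).elim hja hj
      rw [map_sub, l_point_sub, if_neg hj, if_neg hjT] at h2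
      linarith
  have h1 := C.sum_l_nonpos hy' hs hsf
  simp only [map_sub (C.l _) _ y, l_point_sub, Finset.sum_sub_distrib, Finset.sum_boole,
    Finset.filter_mem_eq_inter] at h1
  have h2 : ((C.B f ∩ S).card : ℝ) ≤ 1 := by exact_mod_cast hS.card_inter_le_one f
  have h3 : (1 : ℝ) ≤ (C.B f ∩ T).card := by
    exact_mod_cast Finset.card_pos.2 ⟨a, Finset.mem_inter.2 ⟨haf, ha⟩⟩
  have h4 : ∑ j ∈ C.B f, C.l j y = C.l s y := by
    refine Finset.sum_eq_single_of_mem s hsf fun j hj hjs => hout j fun hjS => ?_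
    exact hS j hjS s hs ⟨hjs, f, hj, hsf⟩
  linarith

theorem point_mem (henum : ∀ p : Fin d → ℤ, intPoint d p ∈ P ↔ p ∈ Set.range m)
    {T : Finset (Fin r)} (hT : IsStable (coverGraph C.B) T) : intPoint d (C.point T) ∈ P := by
  rw [henum]
  exact C.of_stable T hT

/-- The elements of a stable set that is a smooth vertex are simplicial. -/
theorem isSimplicial_of_isSmoothVertexOf
    (henum : ∀ p : Fin d → ℤ, intPoint d p ∈ P ↔ p ∈ Set.range m)
    {S : Finset (Fin r)} (hS : IsStable (coverGraph C.B) S)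
    (hsm : IsSmoothVertexOf P (C.point S)) {s : Fin r} (hs : s ∈ S) :
    IsSimplicial (coverGraph C.B) s := by
  classical
  intro a b hsa hsb hab
  by_contra hnab
  obtain ⟨r', h, hli, hcone, -⟩ := hsm
  change LinearIndependent ℝ (fun j => intPoint d (h j)) at hli
  change polytopeConeAt P (intPoint d (C.point S)) = {y | ∃ lam : Fin r' → ℝ, (∀ j, 0 ≤ lam j) ∧
    y = ∑ j, lam j • intPoint d (h j)} at hcone
  have haS : a ∉ S := fun ha => hS s hs a ha hsa
  have hbS : b ∉ S := fun hb => hS s hs b hb hsb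
  set G := coverGraph C.B with hG
  have hnba : ¬ G.Adj b a := fun h => hnab h.symm
  let e : Finset (Fin r) → Fin d → ℝ := fun T =>
    intPoint d (C.point T) - intPoint d (C.point S)
  have he : ∀ T, IsStable G T → ∃ lam : Fin r' → ℝ, (∀ j, 0 ≤ lam j) ∧
      e T = ∑ j, lam j • intPoint d (h j) := by
    intro T hT
    have : e T ∈ polytopeConeAt P (intPoint d (C.point S)) :=
      ⟨1, zero_le_one, _, C.point_mem henum hT, (one_smul _ _).symm⟩
    rwa [hcone] at this
  have stab1 : ∀ x, IsStable G (insert x (S.filter fun t => ¬ G.Adj x t)) := by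
    intro x i hi j hj hij
    simp only [Finset.mem_insert, Finset.mem_filter] at hi hj
    rcases hi with rfl | ⟨hi, hi'⟩ <;> rcases hj with rfl | ⟨hj, hj'⟩
    · exact hij.ne rfl
    · exact hj' hij
    · exact hi' hij.symm
    · exact hS i hi j hj hij
  have stab3 : IsStable G (S.filter fun t => ¬ (G.Adj a t ∧ G.Adj b t)) :=
    fun i hi j hj => hS i (Finset.mem_filter.1 hi).1 j (Finset.mem_filter.1 hj).1
  have stab4 : IsStable G
      (insert a (insert b (S.filter fun t => ¬ G.Adj a t ∧ ¬ G.Adj b t))) := by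
    intro i hi j hj hij
    simp only [Finset.mem_insert, Finset.mem_filter] at hi hj
    rcases hi with rfl | rfl | ⟨hi, hi', hi''⟩ <;> rcases hj with rfl | rfl | ⟨hj, hj', hj''⟩
    · exact hij.ne rfl
    · exact hnab hij
    · exact hj' hij
    · exact hnba hij
    · exact hij.ne rfl
    · exact hj'' hij
    · exact hi' hij.symm
    · exact hi'' hij.symm
    · exact hS i hi j hj hij
  obtain ⟨p, hp, ep⟩ := he _ (stab1 a)
  obtain ⟨q, hq, eq⟩ := he _ (stab1 b)
  obtain ⟨u, hu, eu⟩ := he _ stab3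
  obtain ⟨v, hv, ev⟩ := he _ stab4
  have hrel : e (insert a (S.filter fun t => ¬ G.Adj a t)) +
      e (insert b (S.filter fun t => ¬ G.Adj b t)) =
      e (S.filter fun t => ¬ (G.Adj a t ∧ G.Adj b t)) +
      e (insert a (insert b (S.filter fun t => ¬ G.Adj a t ∧ ¬ G.Adj b t))) := by
    have hsum : ∑ j ∈ insert a (S.filter fun t => ¬ G.Adj a t), C.g j +
        ∑ j ∈ insert b (S.filter fun t => ¬ G.Adj b t), C.g j =
        ∑ j ∈ S.filter (fun t => ¬ (G.Adj a t ∧ G.Adj b t)), C.g j +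
        ∑ j ∈ insert a (insert b (S.filter fun t => ¬ G.Adj a t ∧ ¬ G.Adj b t)), C.g j := by
      rw [← Finset.sum_union_inter,
        ← Finset.sum_union_inter (s₁ := S.filter fun t => ¬ (G.Adj a t ∧ G.Adj b t))]
      congr 2 <;> ext t <;>
        simp only [Finset.mem_union, Finset.mem_inter, Finset.mem_insert, Finset.mem_filter] <;>
        grind
    have := congrArg (intPoint d) hsum
    simp only [map_add] at this
    simp only [e, point, map_add]
    linear_combination this
  have hcoef : ∀ j, p j + q j = u j + v j := by
    rw [ep, eq, eu, ev, ← Finset.sum_add_distrib, ← Finset.sum_add_distrib, ← sub_eq_zero,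
      ← Finset.sum_sub_distrib] at hrel
    intro j
    have := Fintype.linearIndependent_iff.1 hli (fun j => p j + q j - (u j + v j)) (by
      rw [← hrel]
      refine Finset.sum_congr rfl fun j _ => ?_
      module) j
    linarith
  have hmk : ∀ y : Fin r' → ℝ, (∀ j, 0 ≤ y j) →
      ∑ j, y j • intPoint d (h j) ∈ polytopeConeAt P (intPoint d (C.point S)) := by
    intro y hy
    rw [hcone]
    exact ⟨y, hy, rfl⟩
  have hu₁ := hmk (fun j => min (u j) (p j)) fun j => le_min (hu j) (hp j)
  have hu₂ := hmk (fun j => u j - min (u j) (p j)) fun j => sub_nonneg.2 (min_le_left _ _)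
  have hpu : e (insert a (S.filter fun t => ¬ G.Adj a t)) -
      ∑ j, min (u j) (p j) • intPoint d (h j) ∈
        polytopeConeAt P (intPoint d (C.point S)) := by
    have := hmk (fun j => p j - min (u j) (p j)) fun j => sub_nonneg.2 (min_le_right _ _)
    simp only [sub_smul, Finset.sum_sub_distrib] at this
    rwa [ep]
  have hqu : e (insert b (S.filter fun t => ¬ G.Adj b t)) -
      ∑ j, (u j - min (u j) (p j)) • intPoint d (h j) ∈
        polytopeConeAt P (intPoint d (C.point S)) := by
    have := hmk (fun j => q j - (u j - min (u j) (p j))) fun j => by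
      have h1 := hcoef j
      have h2 := hq j
      have h3 := hv j
      rcases min_cases (u j) (p j) with h | h <;> linarith
    simp only [sub_smul _ (_ - _), Finset.sum_sub_distrib] at this
    rwa [eq]
  have hsplit : ∀ i, C.l i (e (S.filter fun t => ¬ (G.Adj a t ∧ G.Adj b t))) =
      C.l i (∑ j, min (u j) (p j) • intPoint d (h j)) +
      C.l i (∑ j, (u j - min (u j) (p j)) • intPoint d (h j)) := by
    intro i
    rw [← map_add, eu, ← Finset.sum_add_distrib]
    congr 1
    refine Finset.sum_congr rfl fun j _ => ?_
    rw [← add_smul]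
    congr 1
    ring
  have hzero : ∀ i ∉ S, C.l i (∑ j, min (u j) (p j) • intPoint d (h j)) = 0 ∧
      C.l i (∑ j, (u j - min (u j) (p j)) • intPoint d (h j)) = 0 := by
    intro i hi
    have h1 := hsplit i
    rw [l_point_sub, if_neg hi, if_neg fun h => hi (Finset.mem_filter.1 h).1] at h1
    have h2 := C.l_nonneg hu₁ hi
    have h3 := C.l_nonneg hu₂ hi
    constructor <;> linarith
  have h1 := C.l_nonneg_of_adj hS hs hsa (Finset.mem_insert_self a _) (fun j hj =>
    (Finset.mem_insert.1 hj).imp id fun h => (Finset.mem_filter.1 h).1) hu₁ hpu (hzero a haS).1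
  have h2 := C.l_nonneg_of_adj hS hs hsb (Finset.mem_insert_self b _) (fun j hj =>
    (Finset.mem_insert.1 hj).imp id fun h => (Finset.mem_filter.1 h).1) hu₂ hqu (hzero b hbS).2
  have h3 := hsplit s
  rw [l_point_sub, if_pos hs, if_neg (show s ∉ S.filter (fun t => ¬ (G.Adj a t ∧ G.Adj b t)) from
      fun h => (Finset.mem_filter.1 h).2 ⟨hsa.symm, hsb.symm⟩)] at h3
  linarith

/-- If at most one lattice point of `P` is not a smooth vertex, then a non-simplicial vertex of
the graph is adjacent to all other vertices, and these are all simplicial. -/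
theorem adj_and_isSimplicial_of_not_isSimplicial
    (henum : ∀ p : Fin d → ℤ, intPoint d p ∈ P ↔ p ∈ Set.range m)
    (hsing : ∀ v v' : Fin d → ℤ, intPoint d v ∈ P → intPoint d v' ∈ P →
      ¬ IsSmoothVertexOf P v → ¬ IsSmoothVertexOf P v' → v = v')
    {s : Fin r} (hs : ¬ IsSimplicial (coverGraph C.B) s) {t : Fin r} (hts : t ≠ s) :
    (coverGraph C.B).Adj s t ∧ IsSimplicial (coverGraph C.B) t := by
  have hone : ∀ i : Fin r, IsStable (coverGraph C.B) {i} := by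
    intro i x hx y hy hxy
    rw [Finset.mem_singleton] at hx hy
    exact hxy.ne (hx.trans hy.symm)
  have huniq : ∀ (T : Finset (Fin r)) (i : Fin r), IsStable (coverGraph C.B) T → i ∈ T →
      ¬ IsSimplicial (coverGraph C.B) i → T = {s} := by
    intro T i hT hi hns
    refine C.point_injective (hsing _ _ (C.point_mem henum hT) (C.point_mem henum (hone s))
      (fun h => hns (C.isSimplicial_of_isSmoothVertexOf henum hT h hi))
      fun h => hs (C.isSimplicial_of_isSmoothVertexOf henum (hone s) h
        (Finset.mem_singleton_self s)))
  constructor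
  · by_contra hadj
    have hT : IsStable (coverGraph C.B) {s, t} := by
      intro x hx y hy hxy
      simp only [Finset.mem_insert, Finset.mem_singleton] at hx hy
      rcases hx with rfl | rfl <;> rcases hy with rfl | rfl
      · exact hxy.ne rfl
      · exact hadj hxy
      · exact hadj hxy.symm
      · exact hxy.ne rfl
    have := huniq _ s hT (by simp) hs
    have ht : t ∈ ({s, t} : Finset (Fin r)) := by simp
    rw [this, Finset.mem_singleton] at ht
    exact hts ht
  · by_contra ht
    exact hts (Finset.singleton_injective (huniq _ t (hone t) (Finset.mem_singleton_self t) ht))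

end StableCoordinates

end Polytope

/-- the toric ideal of a compressed lattice polytope with at most one
singular vertex admits a quadratic Gröbner basis; in particular it is generated in
degree two. -/
theorem toricIdeal_quadratic_groebner_of_at_most_one_singular
    (d : ℕ) (F : Type) [Fintype F]
    (a : F → Fin d → ℤ) (c : F → ℤ)
    (P : Set (Fin d → ℝ)) (k : ℕ) (m : Fin k → Fin d → ℤ)
    (hlat : P = convexHull ℝ (Set.range fun j => fun i => ((m j i : ℤ) : ℝ)))
    (hinj : Function.Injective m)
    (henum : ∀ p : Fin d → ℤ, (fun i => (p i : ℝ)) ∈ P ↔ p ∈ Set.range m)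
    (hfacet : P = {x : Fin d → ℝ | ∀ f : F, (c f : ℝ) ≤ ∑ i, x i * (a f i : ℝ)})
    (hprim : ∀ f : F, Finset.univ.gcd (a f) = 1)
    -- compressed:
    (hwidth : ∀ f : F, ∀ x ∈ P, ∑ i, x i * (a f i : ℝ) ≤ c f + 1)
    (hwidth' : ∀ f : F, ∃ x ∈ P, ∑ i, x i * (a f i : ℝ) = c f + 1)
    -- at most one singular vertex:
    (hsing : ∀ v w : Fin d → ℤ, (fun i => (v i : ℝ)) ∈ P → (fun i => (w i : ℝ)) ∈ P →
      ¬ IsSmoothVertexOf P v → ¬ IsSmoothVertexOf P w → v = w) :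
    (∃ r : (Fin k →₀ ℕ) → (Fin k →₀ ℕ) → Prop, IsMonomialOrder r ∧
      ∃ G : Finset (MvPolynomial (Fin k) ℂ),
        IsGroebnerBasis r G (toricIdeal m) ∧ ∀ g ∈ G, g.totalDegree ≤ 2) ∧
    GeneratedInDegreeLE (toricIdeal m) 2 := by

  change P = convexHull ℝ (Set.range fun j => intPoint d (m j)) at hlat
  change ∀ p : Fin d → ℤ, intPoint d p ∈ P ↔ p ∈ Set.range m at henum
  by_cases hex : ∃ w, intPoint d w ∈ P ∧ IsSmoothVertexOf P w
  · obtain ⟨w, hw, hsm⟩ := hex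
    have hfacet' : ∀ x, x ∈ P ↔ ∀ f, (c f : ℝ) ≤ intForm (a f) x := fun x => by rw [hfacet]; rfl
    obtain ⟨r, ⟨C⟩⟩ := exists_stableCoordinates hlat henum hfacet' hwidth hw hsm
    choose S hS hm using C.exists_stable
    refine toricIdeal_quadratic_of_stableSets m
      (fun s hs t hts => C.adj_and_isSimplicial_of_not_isSimplicial henum hsing hs hts)
      w C.g S hS hm hinj C.of_stable fun j => ?_
    refine ⟨AddMonoidHom.mk' (fun x : (Fin d → ℤ) × ℤ =>
      C.l j (intPoint d x.1) - x.2 * C.l j (intPoint d w)) fun x y => ?_, fun T => ?_⟩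
    · simp only [Prod.fst_add, Prod.snd_add, map_add, Int.cast_add]
      ring
    · simp [map_add, map_sum, C.dual]
  · push Not at hex
    have hsub : ∀ i j, i = j := fun i j => hinj (hsing _ _ ((henum _).2 ⟨i, rfl⟩)
      ((henum _).2 ⟨j, rfl⟩) (hex _ ((henum _).2 ⟨i, rfl⟩)) (hex _ ((henum _).2 ⟨j, rfl⟩)))
    refine toricIdeal_quadratic_of_setLattice m (fun _ => (∅ : Finset Empty))
      (fun i j _ => hsub i j) (fun i j => ⟨i, j, ?_, ?_, rfl⟩) fun j => j.elim <;> simp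
end
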